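/- arXiv:2301.03757 — 11 statements merged into one kernel-verified Lean document; each statement's English description precedes it below -/
import Mathlib

section
/- The pair of functions u₀(t) = m^{(m-1)/2}·e^{t/2}/(2^{m/2}·cosh(t)^{m/2}) and v₀(t) = m^{(m-1)/2}·e^{-t/2}/(2^{m/2}·cosh(t)^{m/2}) is a solution of the system (S1) on all of ℝ; it satisfies H(u₀(t), v₀(t)) = 0 for every t ∈ ℝ, u₀(t) > 0 and v₀(t) > 0 for all t, and (u₀(t), v₀(t)) → (0,0) as well as (u₀'(t), v₀'(t)) → (0,0) as t → ±∞ (i.e., it is a homoclinic orbit to the origin). -/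
open Real Filter Set Topology

noncomputable section

/-- System (S1): `u' + ((m-1)/2) u = (u²+v²)^{1/(m-1)} v`,
    `-v' + ((m-1)/2) v = (u²+v²)^{1/(m-1)} u`. -/
def IsSolS1 (m : ℕ) (u v : ℝ → ℝ) : Prop :=
  ∀ t : ℝ,
    HasDerivAt u (((u t) ^ 2 + (v t) ^ 2) ^ ((1 : ℝ) / ((m : ℝ) - 1)) * v t
      - (((m : ℝ) - 1) / 2) * u t) t ∧
    HasDerivAt v ((((m : ℝ) - 1) / 2) * v t
      - ((u t) ^ 2 + (v t) ^ 2) ^ ((1 : ℝ) / ((m : ℝ) - 1)) * u t) t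

/-- The Hamiltonian of (S1). -/
def H1 (m : ℕ) (u v : ℝ) : ℝ :=
  -(((m : ℝ) - 1) / 2) * u * v
    + (((m : ℝ) - 1) / (2 * (m : ℝ))) * (u ^ 2 + v ^ 2) ^ ((m : ℝ) / ((m : ℝ) - 1))

/-- The explicit homoclinic profile `u₀`. -/
def u₀ (m : ℕ) (t : ℝ) : ℝ :=
  (m : ℝ) ^ (((m : ℝ) - 1) / 2) * Real.exp (t / 2)
    / ((2 : ℝ) ^ ((m : ℝ) / 2) * Real.cosh t ^ ((m : ℝ) / 2))

/-- The explicit homoclinic profile `v₀`. -/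
def v₀ (m : ℕ) (t : ℝ) : ℝ :=
  (m : ℝ) ^ (((m : ℝ) - 1) / 2) * Real.exp (-t / 2)
    / ((2 : ℝ) ^ ((m : ℝ) / 2) * Real.cosh t ^ ((m : ℝ) / 2))

lemma aux_sq (x y : ℝ) (hx : 0 < x) : (x ^ (y / 2)) ^ 2 = x ^ y := by
  rw [← Real.rpow_natCast, ← Real.rpow_mul hx.le]; congr 1; push_cast; ring

lemma aux_sum (m : ℕ) (hm : 2 ≤ m) (t : ℝ) :
    u₀ m t ^ 2 + v₀ m t ^ 2 = ((m : ℝ) / (2 * Real.cosh t)) ^ ((m : ℝ) - 1) := by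
  have hm' : (0 : ℝ) < m := by positivity
  have hc := Real.cosh_pos t
  have e1 : Real.exp (t / 2) ^ 2 = Real.exp t := by
    rw [← Real.exp_nat_mul]; congr 1; push_cast; ring
  have e2 : Real.exp (-t / 2) ^ 2 = Real.exp (-t) := by
    rw [← Real.exp_nat_mul]; congr 1; push_cast; ring
  unfold u₀ v₀
  rw [div_pow, div_pow, mul_pow, mul_pow, mul_pow, aux_sq _ _ hm', aux_sq _ _ two_pos,
    aux_sq _ _ hc, e1, e2, Real.div_rpow hm'.le (by positivity),
    Real.mul_rpow (by norm_num) hc.le, Real.rpow_sub_one two_pos.ne' (m : ℝ),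
    Real.rpow_sub_one hc.ne' (m : ℝ)]
  have h3 : Real.exp (-t) = 2 * Real.cosh t - Real.exp t := by rw [Real.cosh_eq]; ring
  have h4 : (0 : ℝ) < 2 ^ (m : ℝ) := by positivity
  have h5 : (0 : ℝ) < Real.cosh t ^ (m : ℝ) := by positivity
  rw [h3]
  field_simp
  ring

lemma aux_prod (m : ℕ) (hm : 2 ≤ m) (t : ℝ) :
    u₀ m t * v₀ m t = ((m : ℝ) / (2 * Real.cosh t)) ^ (m : ℝ) / m := by
  have hm' : (0 : ℝ) < m := by positivity
  have hc := Real.cosh_pos t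
  have e1 : Real.exp (-t / 2) = (Real.exp (t / 2))⁻¹ := by
    rw [← Real.exp_neg]; congr 1; ring
  have : u₀ m t * v₀ m t = ((m : ℝ) ^ (((m : ℝ) - 1) / 2)) ^ 2 /
      (((2 : ℝ) ^ ((m : ℝ) / 2)) ^ 2 * (Real.cosh t ^ ((m : ℝ) / 2)) ^ 2) := by
    unfold u₀ v₀
    rw [e1]
    have := Real.exp_pos (t / 2)
    field_simp
  rw [this, aux_sq _ _ hm', aux_sq _ _ two_pos,
    aux_sq _ _ hc, Real.div_rpow hm'.le (by positivity),
    Real.mul_rpow (by norm_num) hc.le, Real.rpow_sub_one hm'.ne' (m : ℝ)]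
  field_simp

lemma aux_pow (m : ℕ) (hm : 2 ≤ m) (t : ℝ) (y : ℝ) :
    (u₀ m t ^ 2 + v₀ m t ^ 2) ^ (y / ((m : ℝ) - 1)) = ((m : ℝ) / (2 * Real.cosh t)) ^ y := by
  have hc := Real.cosh_pos t
  have hm2 : (2 : ℝ) ≤ m := by exact_mod_cast hm
  have : (m : ℝ) - 1 ≠ 0 := by linarith
  rw [aux_sum m hm, ← Real.rpow_mul (by positivity)]
  congr 1
  field_simp

lemma aux_pos (m : ℕ) (hm : 2 ≤ m) (t : ℝ) : 0 < u₀ m t ∧ 0 < v₀ m t := by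
  have hm' : (0 : ℝ) < m := by positivity
  have hc := Real.cosh_pos t
  unfold u₀ v₀
  constructor <;> positivity

lemma aux_symm (m : ℕ) (t : ℝ) : v₀ m t = u₀ m (-t) := by
  unfold u₀ v₀; rw [Real.cosh_neg]

lemma aux_der (m : ℕ) (t : ℝ) :
    HasDerivAt (u₀ m) (u₀ m t * (1 / 2 - m / 2 * (Real.sinh t / Real.cosh t))) t := by
  have hc := Real.cosh_pos t
  have h1 : HasDerivAt (fun s : ℝ => Real.exp (s / 2)) (Real.exp (t / 2) * (1 / 2)) t :=
    ((hasDerivAt_id t).div_const 2).exp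
  have h2 := (Real.hasDerivAt_cosh t).rpow_const (p := (m : ℝ) / 2) (Or.inl hc.ne')
  have h4 : (0 : ℝ) < 2 ^ ((m : ℝ) / 2) := by positivity
  have h5 : (0 : ℝ) < Real.cosh t ^ ((m : ℝ) / 2) := by positivity
  have h := (h1.const_mul ((m : ℝ) ^ (((m : ℝ) - 1) / 2))).div
    (h2.const_mul ((2 : ℝ) ^ ((m : ℝ) / 2))) (by positivity)
  refine h.congr_deriv ?_
  unfold u₀
  rw [Real.rpow_sub_one hc.ne']
  field_simp

lemma aux_sol (m : ℕ) (hm : 2 ≤ m) : IsSolS1 m (u₀ m) (v₀ m) := by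
  intro t
  have hc := Real.cosh_pos t
  have E : Real.exp (-t / 2) = Real.exp (t / 2) * Real.exp (-t) := by
    rw [← Real.exp_add]; congr 1; ring
  have hv : v₀ m t = u₀ m t * Real.exp (-t) := by
    unfold u₀ v₀; rw [E]; ring
  have hu : u₀ m t = v₀ m t * Real.exp t := by
    rw [hv, mul_assoc, ← Real.exp_add]; simp
  rw [aux_pow m hm, Real.rpow_one]
  constructor
  · refine (aux_der m t).congr_deriv ?_
    rw [hv, ← Real.cosh_sub_sinh]
    field_simp
    ring
  · have h : HasDerivAt (fun s => u₀ m (-s)) _ t :=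
      HasDerivAt.comp t (aux_der m (-t)) (hasDerivAt_neg t)
    have hf : v₀ m = fun s => u₀ m (-s) := funext (aux_symm m)
    have h' : HasDerivAt (v₀ m) _ t := hf ▸ h
    refine h'.congr_deriv ?_
    rw [← aux_symm, hu, ← Real.cosh_add_sinh, Real.cosh_neg, Real.sinh_neg]
    field_simp
    ring

lemma aux_bound (m : ℕ) (hm : 2 ≤ m) (t : ℝ) :
    u₀ m t ≤ 2 * (m : ℝ) ^ (((m : ℝ) - 1) / 2) * Real.exp (-(|t| / 2)) := by
  have hc := Real.cosh_pos t
  have hm2 : (2 : ℝ) ≤ m := by exact_mod_cast hm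
  have h1 : Real.exp |t| / 2 ≤ Real.cosh t := by
    rw [← Real.cosh_abs, Real.cosh_eq]; linarith [Real.exp_pos (-|t|)]
  have h2 : Real.cosh t ≤ Real.cosh t ^ ((m : ℝ) / 2) := by
    conv_lhs => rw [← Real.rpow_one (Real.cosh t)]
    exact Real.rpow_le_rpow_of_exponent_le (Real.one_le_cosh t) (by linarith)
  have h3 : (1 : ℝ) ≤ 2 ^ ((m : ℝ) / 2) := Real.one_le_rpow (by norm_num) (by positivity)
  have hA : (0 : ℝ) ≤ (m : ℝ) ^ (((m : ℝ) - 1) / 2) := by positivity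
  have h4 : Real.exp |t| / 2 ≤ 2 ^ ((m : ℝ) / 2) * Real.cosh t ^ ((m : ℝ) / 2) := by
    nlinarith
  have h5 : Real.exp (t / 2) ≤ Real.exp (-(|t| / 2)) * Real.exp |t| := by
    rw [← Real.exp_add]; apply Real.exp_le_exp.2; linarith [le_abs_self t]
  unfold u₀
  rw [div_le_iff₀ (by positivity)]
  calc (m : ℝ) ^ (((m : ℝ) - 1) / 2) * Real.exp (t / 2)
      ≤ (m : ℝ) ^ (((m : ℝ) - 1) / 2) * (Real.exp (-(|t| / 2)) * Real.exp |t|) := by gcongr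
    _ = 2 * (m : ℝ) ^ (((m : ℝ) - 1) / 2) * Real.exp (-(|t| / 2)) * (Real.exp |t| / 2) := by ring
    _ ≤ _ := by gcongr

lemma aux_lim (m : ℕ) (hm : 2 ≤ m) (l : Filter ℝ) (hl : Tendsto (fun t : ℝ => |t|) l atTop) :
    Tendsto (u₀ m) l (𝓝 0) ∧ Tendsto (v₀ m) l (𝓝 0) ∧
    Tendsto (deriv (u₀ m)) l (𝓝 0) ∧ Tendsto (deriv (v₀ m)) l (𝓝 0) := by
  have hb : Tendsto (fun t : ℝ => 2 * (m : ℝ) ^ (((m : ℝ) - 1) / 2) * Real.exp (-(|t| / 2)))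
      l (𝓝 0) := by
    have := (Real.tendsto_exp_neg_atTop_nhds_zero.comp
      (hl.atTop_div_const two_pos)).const_mul (2 * (m : ℝ) ^ (((m : ℝ) - 1) / 2))
    simpa using this
  have hu : Tendsto (u₀ m) l (𝓝 0) :=
    squeeze_zero (fun t => (aux_pos m hm t).1.le) (aux_bound m hm) hb
  have hv : Tendsto (v₀ m) l (𝓝 0) :=
    squeeze_zero (fun t => (aux_pos m hm t).2.le)
      (fun t => by rw [aux_symm]; simpa using aux_bound m hm (-t)) hb
  have hs : Tendsto (fun t => (m : ℝ) * u₀ m t + m * v₀ m t) l (𝓝 0) := by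
    simpa using (hu.const_mul (m : ℝ)).add (hv.const_mul (m : ℝ))
  have hm2 : (2 : ℝ) ≤ m := by exact_mod_cast hm
  have hq : ∀ t, 0 ≤ (m : ℝ) / (2 * Real.cosh t) ∧ (m : ℝ) / (2 * Real.cosh t) ≤ m := by
    intro t
    have h1 := Real.one_le_cosh t
    refine ⟨by positivity, div_le_self (by positivity) (by linarith)⟩
  refine ⟨hu, hv, squeeze_zero_norm (fun t => ?_) hs, squeeze_zero_norm (fun t => ?_) hs⟩
  · rw [(aux_sol m hm t).1.deriv, aux_pow m hm, Real.rpow_one, Real.norm_eq_abs, abs_le]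
    obtain ⟨h1, h2⟩ := aux_pos m hm t
    obtain ⟨h3, h4⟩ := hq t
    constructor <;> nlinarith [mul_nonneg h3 h2.le, mul_le_mul_of_nonneg_right h4 h2.le,
      mul_le_mul_of_nonneg_right hm2 h1.le, mul_le_mul_of_nonneg_right hm2 h2.le]
  · rw [(aux_sol m hm t).2.deriv, aux_pow m hm, Real.rpow_one, Real.norm_eq_abs, abs_le]
    obtain ⟨h1, h2⟩ := aux_pos m hm t
    obtain ⟨h3, h4⟩ := hq t
    constructor <;> nlinarith [mul_nonneg h3 h1.le, mul_le_mul_of_nonneg_right h4 h1.le,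
      mul_le_mul_of_nonneg_right hm2 h1.le, mul_le_mul_of_nonneg_right hm2 h2.le]

theorem stmt2 (m : ℕ) (hm : 2 ≤ m) :
    IsSolS1 m (u₀ m) (v₀ m) ∧
    (∀ t : ℝ, H1 m (u₀ m t) (v₀ m t) = 0) ∧
    (∀ t : ℝ, 0 < u₀ m t ∧ 0 < v₀ m t) ∧
    Tendsto (u₀ m) atTop (𝓝 0) ∧ Tendsto (u₀ m) atBot (𝓝 0) ∧
    Tendsto (v₀ m) atTop (𝓝 0) ∧ Tendsto (v₀ m) atBot (𝓝 0) ∧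
    Tendsto (deriv (u₀ m)) atTop (𝓝 0) ∧ Tendsto (deriv (u₀ m)) atBot (𝓝 0) ∧
    Tendsto (deriv (v₀ m)) atTop (𝓝 0) ∧ Tendsto (deriv (v₀ m)) atBot (𝓝 0) := by
  obtain ⟨a1, a2, a3, a4⟩ := aux_lim m hm atTop tendsto_abs_atTop_atTop
  obtain ⟨b1, b2, b3, b4⟩ := aux_lim m hm atBot tendsto_abs_atBot_atTop
  refine ⟨aux_sol m hm, fun t => ?_, aux_pos m hm, a1, b1, a2, b2, a3, b3, a4, b4⟩
  have hm' : (0 : ℝ) < m := by positivity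
  unfold H1
  rw [aux_pow m hm, mul_assoc, aux_prod m hm]
  field_simp
  ring
end
end

section
/- There exists K̄ > 0 such that for every K with 0 < K < K̄, the function F_K has exactly two zeros on the open interval (0, +∞). -/
open Real Filter Set Topology

noncomputable section

/-- `λ = (m-1)/2`. -/
def lam (m : ℕ) : ℝ := ((m : ℝ) - 1) / 2

/-- `p = m/(m-1)`. -/
def pex (m : ℕ) : ℝ := (m : ℝ) / ((m : ℝ) - 1)

/-- `F_K(s) = s² - ((1/(λp)) s^p + K)²`. -/
def FK (m : ℕ) (K s : ℝ) : ℝ :=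
  s ^ 2 - (1 / (lam m * pex m) * s ^ pex m + K) ^ 2

/-- `F_K` has exactly two zeros on `(0, +∞)`. -/
def HasTwoZeros (m : ℕ) (K : ℝ) : Prop :=
  ∃ s₀ s₁ : ℝ, 0 < s₀ ∧ s₀ < s₁ ∧ FK m K s₀ = 0 ∧ FK m K s₁ = 0 ∧
    ∀ s : ℝ, 0 < s → FK m K s = 0 → s = s₀ ∨ s = s₁

lemma aux_two (c p : ℝ) (hc : 0 < c) (hp : 1 < p) :
    ∃ Kbar : ℝ, 0 < Kbar ∧ ∀ K : ℝ, 0 < K → K < Kbar →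
      ∃ s₀ s₁ : ℝ, 0 < s₀ ∧ s₀ < s₁ ∧ c * s₀ ^ p + K = s₀ ∧ c * s₁ ^ p + K = s₁ ∧
        ∀ s : ℝ, 0 < s → c * s ^ p + K = s → s = s₀ ∨ s = s₁ := by
  have key : ∀ t : ℝ, 0 < t → ∃ a : ℝ, 0 < a ∧ a ^ (p - 1) = t := fun t ht =>
    ⟨t ^ (p - 1)⁻¹, by positivity, Real.rpow_inv_rpow ht.le (by linarith)⟩
  have split : ∀ a : ℝ, 0 < a → a ^ p = a ^ (p - 1) * a := fun a ha => by
    rw [← Real.rpow_add_one ha.ne']; congr 1; ring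
  obtain ⟨a, ha, hat⟩ := key (1 / (2 * c)) (by positivity)
  obtain ⟨b, hb, hbt⟩ := key (1 / c) (by positivity)
  have hab : a < b := by
    have : a ^ (p - 1) < b ^ (p - 1) := by
      rw [hat, hbt]
      exact one_div_lt_one_div_of_lt hc (by linarith)
    exact (Real.rpow_lt_rpow_iff ha.le hb.le (by linarith)).1 this
  have hav : c * a ^ p = a / 2 := by rw [split a ha, hat]; field_simp
  have hbv : c * b ^ p = b := by rw [split b hb, hbt]; field_simp
  have hcv := strictConvexOn_rpow hp
  refine ⟨a / 2, by positivity, fun K hK hKa => ?_⟩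
  have hcont : Continuous (fun s : ℝ => c * s ^ p + K - s) := by
    have : Continuous (fun s : ℝ => s ^ p) := Real.continuous_rpow_const (by linarith)
    fun_prop
  have h0v : c * (0:ℝ) ^ p + K - 0 = K := by
    rw [Real.zero_rpow (by linarith)]; ring
  obtain ⟨s₀, ⟨h1, h2⟩, h3⟩ := intermediate_value_Ioo' ha.le hcont.continuousOn
    (show (0:ℝ) ∈ Ioo _ _ from ⟨by linarith, by linarith⟩)
  obtain ⟨s₁, ⟨h4, h5⟩, h6⟩ := intermediate_value_Ioo hab.le hcont.continuousOn
    (show (0:ℝ) ∈ Ioo _ _ from ⟨by linarith, by linarith⟩)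
  simp only [] at h3 h6
  have three : ∀ x y z : ℝ, 0 < x → x < y → y < z → c * x ^ p + K = x → c * y ^ p + K = y →
      c * z ^ p + K = z → False := by
    intro x y z hx hxy hyz ex ey ez
    have h := hcv.slope_strict_mono_adjacent (x := x) (y := y) (z := z) hx.le (by
      show (0:ℝ) ≤ z
      linarith) hxy hyz
    have e1 : (y ^ p - x ^ p) / (y - x) = 1 / c := by
      have : y - x ≠ 0 := by linarith
      rw [div_eq_div_iff this hc.ne']; linarith
    have e2 : (z ^ p - y ^ p) / (z - y) = 1 / c := by
      have : z - y ≠ 0 := by linarith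
      rw [div_eq_div_iff this hc.ne']; linarith
    rw [e1, e2] at h
    exact lt_irrefl _ h
  have e0 : c * s₀ ^ p + K = s₀ := by linarith
  have e1 : c * s₁ ^ p + K = s₁ := by linarith
  have h01 : s₀ < s₁ := h2.trans h4
  refine ⟨s₀, s₁, h1, h01, e0, e1, fun s hs es => ?_⟩
  by_contra hne
  push Not at hne
  rcases lt_or_gt_of_ne hne.1 with h | h
  · exact three s s₀ s₁ hs h h01 es e0 e1
  · rcases lt_or_gt_of_ne hne.2 with h' | h'
    · exact three s₀ s s₁ h1 h h' e0 es e1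
    · exact three s₀ s₁ s h1 h01 h' e0 e1 es

theorem stmt3 (m : ℕ) (hm : 2 ≤ m) :
    ∃ Kbar : ℝ, 0 < Kbar ∧ ∀ K : ℝ, 0 < K → K < Kbar → HasTwoZeros m K := by
  have hm' : (2:ℝ) ≤ m := by exact_mod_cast hm
  have hm1 : (0:ℝ) < m - 1 := by linarith
  have hp : 1 < pex m := by
    unfold pex
    rw [lt_div_iff₀ hm1]; linarith
  have hc : 0 < 1 / (lam m * pex m) := by
    have : 0 < lam m := by unfold lam; linarith
    have : 0 < pex m := by linarith
    positivity
  obtain ⟨Kb, hKb, H⟩ := aux_two _ _ hc hp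
  refine ⟨Kb, hKb, fun K hK hK' => ?_⟩
  obtain ⟨s₀, s₁, h0, h01, e0, e1, hu⟩ := H K hK hK'
  refine ⟨s₀, s₁, h0, h01, ?_, ?_, fun s hs hz => hu s hs ?_⟩
  · unfold FK; rw [e0]; ring
  · unfold FK; rw [e1]; ring
  · unfold FK at hz
    have h2 : 0 ≤ 1 / (lam m * pex m) * s ^ pex m + K := by positivity
    exact ((sq_eq_sq₀ hs.le h2).1 (by linarith)).symm
end
end

section
/- Let K₀ = sup{K > 0 : F_K has exactly two zeros on (0,+∞)}. Then K₀ < +∞; the function F_{K₀} has exactly one zero on (0,+∞), and this zero is the point where F_{K₀} attains its global maximum (which equals 0); and for every K > K₀ and every s ≥ 0 one has F_K(s) < 0. -/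
open Real Filter Set Topology

noncomputable section

def gg (m : ℕ) (s : ℝ) : ℝ := s - 2 / (m : ℝ) * s ^ pex m

lemma coef (m : ℕ) (hm : 2 ≤ m) : 1 / (lam m * pex m) = 2 / (m : ℝ) := by
  have h2 : (2 : ℝ) ≤ m := by exact_mod_cast hm
  have h1 : (m : ℝ) - 1 ≠ 0 := by linarith
  have h0 : (m : ℝ) ≠ 0 := by linarith
  unfold lam pex
  field_simp

lemma pex_gt (m : ℕ) (hm : 2 ≤ m) : 1 < pex m := by
  have h2 : (2 : ℝ) ≤ m := by exact_mod_cast hm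
  unfold pex
  rw [lt_div_iff₀ (by linarith)]
  linarith

lemma FK_eq (m : ℕ) (hm : 2 ≤ m) (K s : ℝ) :
    FK m K s = (gg m s - K) * (s + 2 / (m : ℝ) * s ^ pex m + K) := by
  unfold FK gg
  rw [coef m hm]
  ring

lemma fac_pos (m : ℕ) (K s : ℝ) (hK : 0 < K) (hs : 0 ≤ s) :
    0 < s + 2 / (m : ℝ) * s ^ pex m + K := by
  have := Real.rpow_nonneg hs (pex m)
  positivity

lemma FK_zero (m : ℕ) (hm : 2 ≤ m) (K s : ℝ) (hK : 0 < K) (hs : 0 ≤ s) :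
    FK m K s = 0 ↔ gg m s = K := by
  rw [FK_eq m hm, mul_eq_zero, or_iff_left (fac_pos m K s hK hs).ne', sub_eq_zero]

lemma pow_pex (m : ℕ) (hm : 2 ≤ m) (r : ℝ) (hr : 0 ≤ r) :
    (r ^ (m - 1)) ^ pex m = r * r ^ (m - 1) := by
  have h2 : (2 : ℝ) ≤ m := by exact_mod_cast hm
  have h1 : (m : ℝ) - 1 ≠ 0 := by linarith
  rw [← Real.rpow_natCast, ← Real.rpow_mul hr, Nat.cast_sub (by omega), Nat.cast_one]
  unfold pex
  rw [mul_div_cancel₀ _ h1, Real.rpow_natCast, ← Nat.cast_one, ← Nat.cast_sub (by omega),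
    Real.rpow_natCast, ← pow_succ']
  congr 1
  omega

def st (m : ℕ) : ℝ := lam m ^ (m - 1)

lemma lam_pos (m : ℕ) (hm : 2 ≤ m) : 0 < lam m := by
  have h2 : (2 : ℝ) ≤ m := by exact_mod_cast hm
  unfold lam
  linarith

lemma st_pos (m : ℕ) (hm : 2 ≤ m) : 0 < st m := pow_pos (lam_pos m hm) _

lemma st_pex (m : ℕ) (hm : 2 ≤ m) : st m ^ pex m = lam m * st m :=
  pow_pex m hm _ (lam_pos m hm).le

lemma gg_st (m : ℕ) (hm : 2 ≤ m) : gg m (st m) = st m / m := by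
  have h0 : (m : ℝ) ≠ 0 := by positivity
  unfold gg
  rw [st_pex m hm]
  unfold lam
  field_simp
  ring

lemma gg_lt (m : ℕ) (hm : 2 ≤ m) (s : ℝ) (hs : 0 ≤ s) (hne : s ≠ st m) :
    gg m s < gg m (st m) := by
  have h2 : (2 : ℝ) ≤ m := by exact_mod_cast hm
  have h1 : (m : ℝ) - 1 ≠ 0 := by linarith
  have hp := st_pos m hm
  obtain ⟨x, hx⟩ : ∃ x, s = st m * (1 + x) := ⟨s / st m - 1, by field_simp; ring⟩
  have hx1 : 0 ≤ 1 + x := by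
    by_contra h
    push Not at h
    nlinarith
  have hx0 : x ≠ 0 := by
    rintro rfl
    apply hne
    simpa using hx
  have hb := one_add_mul_self_lt_rpow_one_add (by linarith : -1 ≤ x) hx0 (pex_gt m hm)
  rw [gg_st m hm]
  unfold gg
  rw [hx, Real.mul_rpow hp.le hx1, st_pex m hm]
  have hl := lam_pos m hm
  have hc : 0 < 2 / (m : ℝ) * (lam m * st m) := by positivity
  have h3 := mul_lt_mul_of_pos_left hb hc
  have h4 : 2 / (m : ℝ) * (lam m * st m) * (1 + pex m * x)
      = st m * (1 + x) - st m / m := by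
    unfold lam pex
    field_simp
    ring
  linarith

lemma gg_cont (m : ℕ) (hm : 2 ≤ m) : Continuous (gg m) := by
  have := pex_gt m hm
  unfold gg
  exact continuous_id.sub (continuous_const.mul (Real.continuous_rpow_const (by linarith)))

lemma three (m : ℕ) (hm : 2 ≤ m) (a b c : ℝ) (ha : 0 ≤ a) (hab : a < b) (hbc : b < c)
    (h1 : gg m a = gg m b) (h2 : gg m b = gg m c) : False := by
  have h0 : (0 : ℝ) < m := by positivity
  have h := (strictConvexOn_rpow (pex_gt m hm)).slope_strict_mono_adjacent
    (mem_Ici.2 ha) (mem_Ici.2 (by linarith : (0 : ℝ) ≤ c)) hab hbc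
  unfold gg at h1 h2
  have e1 : b ^ pex m - a ^ pex m = (m : ℝ) / 2 * (b - a) := by
    field_simp at h1 ⊢
    linarith
  have e2 : c ^ pex m - b ^ pex m = (m : ℝ) / 2 * (c - b) := by
    field_simp at h2 ⊢
    linarith
  have hab' : b - a ≠ 0 := by linarith
  have hbc' : c - b ≠ 0 := by linarith
  rw [e1, e2, mul_div_cancel_right₀ _ hab', mul_div_cancel_right₀ _ hbc'] at h
  exact lt_irrefl _ h

lemma set_eq (m : ℕ) (hm : 2 ≤ m) :
    {K : ℝ | 0 < K ∧ HasTwoZeros m K} = Ioo 0 (gg m (st m)) := by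
  have h0 : (0 : ℝ) < m := by positivity
  have hsp := st_pos m hm
  have hpp := pex_gt m hm
  ext K
  simp only [mem_setOf_eq, mem_Ioo]
  refine and_congr_right fun hK => ⟨?_, ?_⟩
  · rintro ⟨a, b, ha, hab, h1, h2, -⟩
    rw [FK_zero m hm K _ hK ha.le] at h1
    rw [FK_zero m hm K _ hK (by linarith)] at h2
    by_cases h : a = st m
    · rw [← h2]
      exact gg_lt m hm b (by linarith) (by rw [← h]; exact hab.ne')
    · rw [← h1]
      exact gg_lt m hm a ha.le h
  · intro hlt
    have g0 : gg m 0 = 0 := by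
      unfold gg
      rw [Real.zero_rpow (by linarith)]
      simp
    have gb : gg m (((m : ℝ) / 2) ^ (m - 1)) = 0 := by
      unfold gg
      rw [pow_pex m hm _ (by positivity)]
      field_simp
      ring
    have hle : st m ≤ ((m : ℝ) / 2) ^ (m - 1) := by
      unfold st
      apply pow_le_pow_left₀ (lam_pos m hm).le
      unfold lam
      linarith
    obtain ⟨a, ⟨ha0, ha1⟩, ha⟩ := intermediate_value_Ioo hsp.le (gg_cont m hm).continuousOn
      (show K ∈ Ioo (gg m 0) (gg m (st m)) from ⟨by rw [g0]; exact hK, hlt⟩)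
    obtain ⟨b, ⟨hb0, hb1⟩, hb⟩ := intermediate_value_Ioo' hle (gg_cont m hm).continuousOn
      (show K ∈ Ioo _ (gg m (st m)) from ⟨by rw [gb]; exact hK, hlt⟩)
    have hab : a < b := by linarith
    refine ⟨a, b, ha0, hab, (FK_zero m hm K a hK ha0.le).2 ha,
      (FK_zero m hm K b hK (by linarith)).2 hb, ?_⟩
    intro s hs h
    rw [FK_zero m hm K s hK hs.le] at h
    by_contra hn
    push Not at hn
    obtain ⟨n1, n2⟩ := hn
    rcases lt_or_gt_of_ne n1 with h1 | h1
    · exact three m hm s a b hs.le h1 hab (h.trans ha.symm) (ha.trans hb.symm)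
    · rcases lt_or_gt_of_ne n2 with h3 | h3
      · exact three m hm a s b ha0.le h1 h3 (ha.trans h.symm) (h.trans hb.symm)
      · exact three m hm a b s ha0.le hab h3 (ha.trans hb.symm) (hb.trans h.symm)

theorem stmt4 (m : ℕ) (hm : 2 ≤ m) :
    BddAbove {K : ℝ | 0 < K ∧ HasTwoZeros m K} ∧
    (∃ s₀ : ℝ, 0 < s₀ ∧
      FK m (sSup {K : ℝ | 0 < K ∧ HasTwoZeros m K}) s₀ = 0 ∧
      (∀ s : ℝ, 0 < s → FK m (sSup {K : ℝ | 0 < K ∧ HasTwoZeros m K}) s = 0 → s = s₀) ∧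
      (∀ s : ℝ, 0 ≤ s → FK m (sSup {K : ℝ | 0 < K ∧ HasTwoZeros m K}) s ≤
        FK m (sSup {K : ℝ | 0 < K ∧ HasTwoZeros m K}) s₀)) ∧
    (∀ K : ℝ, sSup {K : ℝ | 0 < K ∧ HasTwoZeros m K} < K →
      ∀ s : ℝ, 0 ≤ s → FK m K s < 0) := by
  have hsp := st_pos m hm
  have hK0 : 0 < gg m (st m) := by
    rw [gg_st m hm]
    have h0 : (0 : ℝ) < m := by positivity
    positivity
  have hmax : ∀ s : ℝ, 0 ≤ s → gg m s ≤ gg m (st m) := by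
    intro s hs
    by_cases h : s = st m
    · rw [h]
    · exact (gg_lt m hm s hs h).le
  rw [set_eq m hm, csSup_Ioo hK0]
  have hz := (FK_zero m hm _ (st m) hK0 hsp.le).2 rfl
  refine ⟨bddAbove_Ioo, ⟨st m, hsp, hz, ?_, ?_⟩, ?_⟩
  · intro s hs h
    rw [FK_zero m hm _ s hK0 hs.le] at h
    by_contra hne
    exact (gg_lt m hm s hs.le hne).ne h
  · intro s hs
    rw [hz, FK_eq m hm]
    exact mul_nonpos_of_nonpos_of_nonneg (by linarith [hmax s hs]) (fac_pos m _ s hK0 hs).le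
  · intro K hK s hs
    rw [FK_eq m hm]
    exact mul_neg_of_neg_of_pos (by linarith [hmax s hs]) (fac_pos m _ s (hK0.trans hK) hs)
end
end

section
/- For every μ > 0 there is a unique pair (u_μ, v_μ) ∈ C¹(ℝ, ℝ²) solving the system (S2) on all of ℝ with u_μ(0) = v_μ(0) = μ (in particular, the maximal solution does not blow up in finite time). Furthermore, (u_μ, v_μ) depends continuously on μ, uniformly on every compact interval [−T, T] with T > 0, and it satisfies the symmetry u_μ(t) = v_μ(−t) and v_μ(t) = u_μ(−t) for all t. -/
open Real Filter Set Topology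

noncomputable section

/-- System (S2): `u' + ((m-2)/2) u = cosh(t)^{-1/(m-1)} (u²+v²)^{1/(m-1)} v`,
    `-v' + ((m-2)/2) v = cosh(t)^{-1/(m-1)} (u²+v²)^{1/(m-1)} u`. -/
def IsSolS2 (m : ℕ) (u v : ℝ → ℝ) : Prop :=
  ∀ t : ℝ,
    HasDerivAt u (Real.cosh t ^ (-(1 : ℝ) / ((m : ℝ) - 1))
        * ((u t) ^ 2 + (v t) ^ 2) ^ ((1 : ℝ) / ((m : ℝ) - 1)) * v t
      - (((m : ℝ) - 2) / 2) * u t) t ∧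
    HasDerivAt v ((((m : ℝ) - 2) / 2) * v t
      - Real.cosh t ^ (-(1 : ℝ) / ((m : ℝ) - 1))
        * ((u t) ^ 2 + (v t) ^ 2) ^ ((1 : ℝ) / ((m : ℝ) - 1)) * u t) t

/-- The (time-dependent) energy of (S2). -/
def H2 (m : ℕ) (t u v : ℝ) : ℝ :=
  -(((m : ℝ) - 2) / 2) * u * v
    + (((m : ℝ) - 1) / (2 * (m : ℝ))) * Real.cosh t ^ (-(1 : ℝ) / ((m : ℝ) - 1))
      * (u ^ 2 + v ^ 2) ^ ((m : ℝ) / ((m : ℝ) - 1))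

open ComplexConjugate in
/-- complex form of the vector field -/
def FF (c q : ℝ) (h : ℝ → ℝ) (t : ℝ) (z : ℂ) : ℂ :=
  -(Complex.I * ((h t * ‖z‖ ^ q : ℝ) : ℂ) * z) - (c : ℂ) * conj z

/-- cutoff -/
def psi (R : ℝ) (z : ℂ) : ℝ := max 0 (min 1 (R + 1 - ‖z‖))

lemma gron {E : Type*} [NormedAddCommGroup E] [NormedSpace ℝ E] (f f' : ℝ → E) (K T : ℝ)
    (hf : ∀ t, |t| < T → HasDerivAt f (f' t) t)
    (hb : ∀ t, |t| < T → ‖f' t‖ ≤ K * ‖f t‖) (t : ℝ) (ht : |t| < T) :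
    ‖f t‖ ≤ ‖f 0‖ * Real.exp (K * |t|) := by
  have pos : ∀ (f f' : ℝ → E), (∀ t, |t| < T → HasDerivAt f (f' t) t) →
      (∀ t, |t| < T → ‖f' t‖ ≤ K * ‖f t‖) → ∀ t, 0 ≤ t → t < T →
      ‖f t‖ ≤ ‖f 0‖ * Real.exp (K * t) := by
    intro f f' hf hb t h0 hT
    have habs : ∀ x ∈ Icc 0 t, |x| < T := fun x hx => by
      rw [abs_of_nonneg hx.1]; exact hx.2.trans_lt hT
    have := norm_le_gronwallBound_of_norm_deriv_right_le (f := f) (f' := f') (δ := ‖f 0‖) (K := K)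
      (ε := 0) (a := 0) (b := t)
      (fun x hx => (hf x (habs x hx)).continuousAt.continuousWithinAt)
      (fun x hx => (hf x (habs x ⟨hx.1, hx.2.le⟩)).hasDerivWithinAt) le_rfl
      (fun x hx => by simpa using hb x (habs x ⟨hx.1, hx.2.le⟩)) t ⟨h0, le_rfl⟩
    simpa [gronwallBound_ε0] using this
  rcases le_total 0 t with h0 | h0
  · rw [abs_of_nonneg h0] at ht ⊢
    exact pos f f' hf hb t h0 ht
  · rw [abs_of_nonpos h0] at ht ⊢
    have := pos (fun s => f (-s)) (fun s => -f' (-s)) (fun s hs => by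
      have h1 := hf (-s) (by simpa using hs)
      simpa [Function.comp_def] using h1.scomp s (hasDerivAt_neg s)) (fun s hs => by
      simpa using hb (-s) (by simpa using hs)) (-t) (by linarith) ht
    simpa using this

open ComplexConjugate in
lemma inner_bd (c a b : ℝ) (hc : 0 ≤ c) (hb0 : 0 ≤ b) (hb1 : b ≤ 1) (z : ℂ) :
    |2 * inner ℝ z ((b : ℂ) * (-(Complex.I * (a : ℂ) * z) - (c : ℂ) * conj z))|
      ≤ 2 * c * ‖z‖ ^ 2 := by
  have e : (2 * inner ℝ z ((b : ℂ) * (-(Complex.I * (a : ℂ) * z) - (c : ℂ) * conj z)) : ℝ)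
      = 2 * (c * b) * (z.im ^ 2 - z.re ^ 2) := by
    rw [Complex.inner]
    simp
    ring
  rw [e, Complex.sq_norm, Complex.normSq_apply, abs_mul, abs_of_nonneg (by positivity)]
  have h1 : |z.im ^ 2 - z.re ^ 2| ≤ z.re * z.re + z.im * z.im := by
    rw [abs_le]; constructor <;> nlinarith [sq_nonneg z.re, sq_nonneg z.im]
  have h2 : c * b ≤ c := mul_le_of_le_one_right hc hb1
  apply mul_le_mul _ h1 (abs_nonneg _) (by positivity)
  linarith

lemma apriori (c q : ℝ) (h : ℝ → ℝ) (hc : 0 ≤ c) (T : ℝ) (z : ℝ → ℂ) (b : ℝ → ℝ)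
    (hb : ∀ t, 0 ≤ b t ∧ b t ≤ 1)
    (hz : ∀ t, |t| < T → HasDerivAt z ((b t : ℂ) * FF c q h t (z t)) t)
    (t : ℝ) (ht : |t| < T) : ‖z t‖ ≤ ‖z 0‖ * Real.exp (c * T) := by
  have := gron (fun t => ‖z t‖ ^ 2) _ (2 * c) T (fun t ht => (hz t ht).norm_sq)
    (fun t ht => by
      have := inner_bd c (h t * ‖z t‖ ^ q) (b t) hc (hb t).1 (hb t).2 (z t)
      simpa [FF] using this) t ht
  have h2 : Real.exp (2 * c * |t|) ≤ Real.exp (c * T) ^ 2 := by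
    rw [← Real.exp_nat_mul]
    apply Real.exp_le_exp.2
    push_cast
    nlinarith
  have h3 : ‖z t‖ ^ 2 ≤ (‖z 0‖ * Real.exp (c * T)) ^ 2 := by
    rw [mul_pow]
    simp only [norm_pow, norm_norm] at this
    exact this.trans (by gcongr)
  exact (sq_le_sq₀ (norm_nonneg _) (by positivity)).1 h3

lemma powlip (q B : ℝ) (hq : 0 < q) (hq1 : q ≤ 1) (x y : ℂ) (hx : ‖x‖ ≤ B) (hyx : ‖y‖ ≤ ‖x‖) :
    ‖((‖x‖ ^ q : ℝ) : ℂ) * x - ((‖y‖ ^ q : ℝ) : ℂ) * y‖ ≤ 2 * B ^ q * ‖x - y‖ := by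
  have hxq : ‖x‖ ^ q ≤ B ^ q := Real.rpow_le_rpow (norm_nonneg _) hx hq.le
  have hyq : ‖y‖ ^ q ≤ ‖x‖ ^ q := Real.rpow_le_rpow (norm_nonneg _) hyx hq.le
  have hy0 : 0 ≤ ‖y‖ ^ q := Real.rpow_nonneg (norm_nonneg _) _
  have hx0 : 0 ≤ ‖x‖ ^ q := Real.rpow_nonneg (norm_nonneg _) _
  have key : ‖x‖ ^ q * ‖y‖ ≤ ‖x‖ * ‖y‖ ^ q := by
    have e : ∀ w : ℂ, ‖w‖ = ‖w‖ ^ q * ‖w‖ ^ (1 - q) := fun w => by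
      rw [← Real.rpow_add_of_nonneg (norm_nonneg _) hq.le (by linarith)]
      simp
    have hm : ‖y‖ ^ (1 - q) ≤ ‖x‖ ^ (1 - q) :=
      Real.rpow_le_rpow (norm_nonneg _) hyx (by linarith)
    calc ‖x‖ ^ q * ‖y‖ = ‖x‖ ^ q * ‖y‖ ^ q * ‖y‖ ^ (1 - q) := by
          conv_lhs => rw [e y]
          ring
      _ ≤ ‖x‖ ^ q * ‖y‖ ^ q * ‖x‖ ^ (1 - q) := by gcongr
      _ = ‖x‖ * ‖y‖ ^ q := by
          conv_rhs => rw [e x]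
          ring
  have e1 : ((‖x‖ ^ q : ℝ) : ℂ) * x - ((‖y‖ ^ q : ℝ) : ℂ) * y
      = ((‖x‖ ^ q : ℝ) : ℂ) * (x - y) + ((‖x‖ ^ q - ‖y‖ ^ q : ℝ) : ℂ) * y := by
    push_cast; ring
  have hn := norm_sub_norm_le x y
  calc _ ≤ ‖x‖ ^ q * ‖x - y‖ + (‖x‖ ^ q - ‖y‖ ^ q) * ‖y‖ := by
        rw [e1]
        refine (norm_add_le _ _).trans (le_of_eq ?_)
        rw [norm_mul, norm_mul, Complex.norm_real, Complex.norm_real, Real.norm_of_nonneg hx0,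
          Real.norm_of_nonneg (sub_nonneg.2 hyq)]
    _ ≤ ‖x‖ ^ q * ‖x - y‖ + ‖y‖ ^ q * ‖x - y‖ := by nlinarith
    _ ≤ 2 * B ^ q * ‖x - y‖ := by nlinarith [norm_nonneg (x - y)]

lemma FFlip (c q B : ℝ) (h : ℝ → ℝ) (hc : 0 ≤ c) (hq : 0 < q) (hq1 : q ≤ 1)
    (hh : ∀ t, 0 ≤ h t ∧ h t ≤ 1) (t : ℝ) (x y : ℂ) (hx : ‖x‖ ≤ B) (hy : ‖y‖ ≤ B) :
    ‖FF c q h t x - FF c q h t y‖ ≤ (2 * B ^ q + c) * ‖x - y‖ := by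
  have hp : ‖((‖x‖ ^ q : ℝ) : ℂ) * x - ((‖y‖ ^ q : ℝ) : ℂ) * y‖ ≤ 2 * B ^ q * ‖x - y‖ := by
    rcases le_total ‖y‖ ‖x‖ with h1 | h1
    · exact powlip q B hq hq1 x y hx h1
    · rw [norm_sub_rev, norm_sub_rev x y]
      exact powlip q B hq hq1 y x hy h1
  have e : FF c q h t x - FF c q h t y =
      -(Complex.I * (h t : ℂ) * (((‖x‖ ^ q : ℝ) : ℂ) * x - ((‖y‖ ^ q : ℝ) : ℂ) * y))
        - (c : ℂ) * (starRingEnd ℂ) (x - y) := by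
    simp only [FF, map_sub]; push_cast; ring
  rw [e]
  refine (norm_sub_le _ _).trans ?_
  rw [norm_neg, norm_mul, norm_mul, norm_mul, Complex.norm_I, Complex.norm_real, Complex.norm_real,
    Real.norm_of_nonneg hc, Real.norm_of_nonneg (hh t).1, RCLike.norm_conj]
  have := mul_le_of_le_one_left
    (norm_nonneg (((‖x‖ ^ q : ℝ) : ℂ) * x - ((‖y‖ ^ q : ℝ) : ℂ) * y)) (hh t).2
  linarith

lemma FFzero (c q : ℝ) (h : ℝ → ℝ) (t : ℝ) : FF c q h t 0 = 0 := by simp [FF]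

lemma psi_mem (R : ℝ) (z : ℂ) : 0 ≤ psi R z ∧ psi R z ≤ 1 :=
  ⟨le_max_left _ _, max_le zero_le_one (min_le_left _ _)⟩

lemma psi_one (R : ℝ) (z : ℂ) (hz : ‖z‖ ≤ R) : psi R z = 1 := by
  unfold psi; rw [min_eq_left (by linarith), max_eq_right zero_le_one]

lemma psi_zero (R : ℝ) (z : ℂ) (hz : R + 1 ≤ ‖z‖) : psi R z = 0 := by
  unfold psi; exact max_eq_left ((min_le_right _ _).trans (by linarith))

lemma psi_lip (R : ℝ) (x y : ℂ) : |psi R x - psi R y| ≤ ‖x - y‖ := by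
  unfold psi
  have h1 := abs_norm_sub_norm_le x y
  have h2 := abs_max_sub_max_le_abs (min 1 (R + 1 - ‖x‖)) (min 1 (R + 1 - ‖y‖)) 0
  have h3 := abs_min_sub_min_le_max 1 (R + 1 - ‖x‖) 1 (R + 1 - ‖y‖)
  rw [max_comm 0, max_comm 0]
  refine h2.trans (h3.trans ?_)
  have : R + 1 - ‖x‖ - (R + 1 - ‖y‖) = -(‖x‖ - ‖y‖) := by ring
  rw [this, abs_neg]
  simpa using h1

lemma Gbd (c q R : ℝ) (h : ℝ → ℝ) (hc : 0 ≤ c) (hq : 0 < q) (hq1 : q ≤ 1) (hR : 0 ≤ R)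
    (hh : ∀ t, 0 ≤ h t ∧ h t ≤ 1) (t : ℝ) (x : ℂ) :
    ‖(psi R x : ℂ) * FF c q h t x‖ ≤ (2 * (R + 1) ^ q + c) * (R + 1) := by
  have hk : 0 ≤ (2 * (R + 1) ^ q + c) := by positivity
  rcases le_total ‖x‖ (R + 1) with h1 | h1
  · have h2 := FFlip c q (R + 1) h hc hq hq1 hh t x 0 h1 (by simp; linarith)
    rw [FFzero, sub_zero, sub_zero] at h2
    rw [norm_mul, Complex.norm_real, Real.norm_of_nonneg (psi_mem R x).1]
    calc _ ≤ ‖FF c q h t x‖ := mul_le_of_le_one_left (norm_nonneg _) (psi_mem R x).2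
      _ ≤ _ := h2.trans (by gcongr)
  · rw [psi_zero R x h1]; simp; positivity

lemma Glip (c q R : ℝ) (h : ℝ → ℝ) (hc : 0 ≤ c) (hq : 0 < q) (hq1 : q ≤ 1) (hR : 0 ≤ R)
    (hh : ∀ t, 0 ≤ h t ∧ h t ≤ 1) (t : ℝ) (x y : ℂ) :
    ‖(psi R x : ℂ) * FF c q h t x - (psi R y : ℂ) * FF c q h t y‖
      ≤ (2 * (R + 1) ^ q + c) * (R + 2) * ‖x - y‖ := by
  have hk : 0 ≤ (2 * (R + 1) ^ q + c) := by positivity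
  have main : ∀ x y : ℂ, ‖x‖ ≤ R + 1 → ‖(psi R x : ℂ) * FF c q h t x - (psi R y : ℂ) * FF c q h t y‖
      ≤ (2 * (R + 1) ^ q + c) * (R + 2) * ‖x - y‖ := by
    intro x y hx
    have e : (psi R x : ℂ) * FF c q h t x - (psi R y : ℂ) * FF c q h t y
      = ((psi R x - psi R y : ℝ) : ℂ) * FF c q h t x
        + (psi R y : ℂ) * (FF c q h t x - FF c q h t y) := by push_cast; ring
    have h2 := FFlip c q (R + 1) h hc hq hq1 hh t x 0 hx (by simp; linarith)
    rw [FFzero, sub_zero, sub_zero] at h2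
    have h3 : ‖FF c q h t x‖ ≤ (2 * (R + 1) ^ q + c) * (R + 1) := h2.trans (by gcongr)
    have h4 : ‖(psi R y : ℂ) * (FF c q h t x - FF c q h t y)‖
        ≤ (2 * (R + 1) ^ q + c) * ‖x - y‖ := by
      rcases le_total ‖y‖ (R + 1) with h1 | h1
      · rw [norm_mul, Complex.norm_real, Real.norm_of_nonneg (psi_mem R y).1]
        exact (mul_le_of_le_one_left (norm_nonneg _) (psi_mem R y).2).trans
          (FFlip c q (R + 1) h hc hq hq1 hh t x y hx h1)
      · rw [psi_zero R y h1]; simp; positivity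
    rw [e]
    refine (norm_add_le _ _).trans ?_
    rw [norm_mul, Complex.norm_real, Real.norm_eq_abs]
    calc _ ≤ ‖x - y‖ * ((2 * (R + 1) ^ q + c) * (R + 1)) + (2 * (R + 1) ^ q + c) * ‖x - y‖ :=
          add_le_add (mul_le_mul (psi_lip R x y) h3 (norm_nonneg _) (norm_nonneg _)) h4
      _ = _ := by ring
  rcases le_total ‖x‖ (R + 1) with h1 | h1
  · exact main x y h1
  rcases le_total ‖y‖ (R + 1) with h2 | h2
  · rw [norm_sub_rev, norm_sub_rev x y]; exact main y x h2
  · rw [psi_zero R x h1, psi_zero R y h2]; simp; positivity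

lemma local_exist (c q : ℝ) (h : ℝ → ℝ) (hc : 0 ≤ c) (hq : 0 < q) (hq1 : q ≤ 1)
    (hh : ∀ t, 0 ≤ h t ∧ h t ≤ 1) (hcont : Continuous h) (z0 : ℂ) (T : ℝ) (hT : 0 < T) :
    ∃ z : ℝ → ℂ, z 0 = z0 ∧ ∀ t, |t| < T → HasDerivAt z (FF c q h t (z t)) t := by
  set R : ℝ := ‖z0‖ * Real.exp (c * T) with hRdef
  have hR : 0 ≤ R := by positivity
  set L : ℝ := (2 * (R + 1) ^ q + c) * (R + 1) with hL
  set K : ℝ := (2 * (R + 1) ^ q + c) * (R + 2) with hK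
  have hL0 : 0 ≤ L := by positivity
  have hK0 : 0 ≤ K := by positivity
  have hp : IsPicardLindelof (fun t x => (psi R x : ℂ) * FF c q h t x) (tmin := -T) (tmax := T)
      ⟨0, by constructor <;> linarith⟩ z0 ⟨L * T, by positivity⟩ 0 ⟨L, hL0⟩ ⟨K, hK0⟩ := by
    refine ⟨fun t _ => ?_, fun x _ => ?_, fun t _ x _ => ?_, ?_⟩
    · refine (LipschitzWith.of_dist_le_mul fun x y => ?_).lipschitzOnWith
      rw [dist_eq_norm, dist_eq_norm]
      exact Glip c q R h hc hq hq1 hR hh t x y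
    · apply Continuous.continuousOn
      unfold FF
      fun_prop
    · exact Gbd c q R h hc hq hq1 hR hh t x
    · show L * max (T - 0) (0 - -T) ≤ L * T - 0
      simp
  obtain ⟨z, hz0, hz⟩ := hp.exists_eq_forall_mem_Icc_hasDerivWithinAt₀
  have hz' : ∀ t, |t| < T → HasDerivAt z ((psi R (z t) : ℂ) * FF c q h t (z t)) t := by
    intro t ht
    rw [abs_lt] at ht
    exact (hz t ⟨ht.1.le, ht.2.le⟩).hasDerivAt (Icc_mem_nhds ht.1 ht.2)
  have hz0' : z 0 = z0 := hz0
  refine ⟨z, hz0', fun t ht => ?_⟩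
  have hb := apriori c q h hc T z (fun t => psi R (z t)) (fun t => psi_mem _ _) hz' t ht
  rw [hz0'] at hb
  have := hz' t ht
  rwa [psi_one R _ hb, Complex.ofReal_one, one_mul] at this

lemma dep (c q : ℝ) (h : ℝ → ℝ) (hc : 0 ≤ c) (hq : 0 < q) (hq1 : q ≤ 1)
    (hh : ∀ t, 0 ≤ h t ∧ h t ≤ 1) (T A : ℝ) (z w : ℝ → ℂ)
    (hz : ∀ t, |t| < T → HasDerivAt z (FF c q h t (z t)) t)
    (hw : ∀ t, |t| < T → HasDerivAt w (FF c q h t (w t)) t)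
    (hzA : ‖z 0‖ ≤ A) (hwA : ‖w 0‖ ≤ A) (t : ℝ) (ht : |t| < T) :
    ‖z t - w t‖ ≤ ‖z 0 - w 0‖ * Real.exp ((2 * (A * Real.exp (c * T)) ^ q + c) * |t|) := by
  have bd : ∀ z : ℝ → ℂ, (∀ t, |t| < T → HasDerivAt z (FF c q h t (z t)) t) → ‖z 0‖ ≤ A →
      ∀ t, |t| < T → ‖z t‖ ≤ A * Real.exp (c * T) := by
    intro z hz hA t ht
    refine (apriori c q h hc T z (fun _ => 1) (fun _ => by norm_num)
      (fun t ht => by simpa using hz t ht) t ht).trans (by gcongr)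
  exact gron (fun t => z t - w t) _ _ T (fun t ht => (hz t ht).sub (hw t ht))
    (fun t ht => FFlip c q _ h hc hq hq1 hh t _ _ (bd z hz hzA t ht) (bd w hw hwA t ht)) t ht

lemma uniq (c q : ℝ) (h : ℝ → ℝ) (hc : 0 ≤ c) (hq : 0 < q) (hq1 : q ≤ 1)
    (hh : ∀ t, 0 ≤ h t ∧ h t ≤ 1) (T : ℝ) (z w : ℝ → ℂ)
    (hz : ∀ t, |t| < T → HasDerivAt z (FF c q h t (z t)) t)
    (hw : ∀ t, |t| < T → HasDerivAt w (FF c q h t (w t)) t)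
    (h0 : z 0 = w 0) (t : ℝ) (ht : |t| < T) : z t = w t := by
  have := dep c q h hc hq hq1 hh T ‖z 0‖ z w hz hw le_rfl (by rw [h0]) t ht
  rw [h0, sub_self, norm_zero, zero_mul] at this
  exact sub_eq_zero.1 (norm_le_zero_iff.1 this)

lemma global_exist (c q : ℝ) (h : ℝ → ℝ) (hc : 0 ≤ c) (hq : 0 < q) (hq1 : q ≤ 1)
    (hh : ∀ t, 0 ≤ h t ∧ h t ≤ 1) (hcont : Continuous h) (z0 : ℂ) :
    ∃ z : ℝ → ℂ, z 0 = z0 ∧ ∀ t, HasDerivAt z (FF c q h t (z t)) t := by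
  choose α hα0 hα using fun n : ℕ =>
    local_exist c q h hc hq hq1 hh hcont z0 ((n : ℝ) + 1) (by positivity)
  have key : ∀ (N : ℕ) (t : ℝ), |t| ≤ N → α ⌈|t|⌉₊ t = α N t := by
    intro N t ht
    have h1 : ⌈|t|⌉₊ ≤ N := Nat.ceil_le.2 ht
    have h1' : ((⌈|t|⌉₊ : ℕ) : ℝ) ≤ N := by exact_mod_cast h1
    refine uniq c q h hc hq hq1 hh ((⌈|t|⌉₊ : ℝ) + 1) _ _ (hα _)
      (fun s hs => hα N s (by linarith)) (by rw [hα0, hα0]) t ?_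
    have := Nat.le_ceil |t|
    linarith
  refine ⟨fun t => α ⌈|t|⌉₊ t, by simp [hα0], fun t => ?_⟩
  set N := ⌈|t|⌉₊ + 1 with hN
  have hlt : |t| < N := by
    have := Nat.le_ceil |t|
    rw [hN]; push_cast; linarith
  have hev : (fun t => α ⌈|t|⌉₊ t) =ᶠ[𝓝 t] α N := by
    filter_upwards [continuous_abs.continuousAt.eventually (gt_mem_nhds hlt)] with s hs
    exact key N s hs.le
  have h2 := hα N t (by linarith)
  show HasDerivAt _ (FF c q h t (α ⌈|t|⌉₊ t)) t
  rw [key N t hlt.le]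
  exact h2.congr_of_eventuallyEq hev

/-- the time weight -/
def hw (m : ℕ) (t : ℝ) : ℝ := Real.cosh t ^ (-(1 : ℝ) / ((m : ℝ) - 1))

lemma FF_eq (m : ℕ) (t u v : ℝ) :
    FF (((m : ℝ) - 2) / 2) (2 / ((m : ℝ) - 1)) (hw m) t ⟨u, v⟩ =
    ⟨Real.cosh t ^ (-(1 : ℝ) / ((m : ℝ) - 1)) * (u ^ 2 + v ^ 2) ^ ((1 : ℝ) / ((m : ℝ) - 1)) * v
      - (((m : ℝ) - 2) / 2) * u, (((m : ℝ) - 2) / 2) * v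
      - Real.cosh t ^ (-(1 : ℝ) / ((m : ℝ) - 1))
        * (u ^ 2 + v ^ 2) ^ ((1 : ℝ) / ((m : ℝ) - 1)) * u⟩ := by
  have e : ‖(⟨u, v⟩ : ℂ)‖ ^ (2 / ((m : ℝ) - 1)) = (u ^ 2 + v ^ 2) ^ ((1 : ℝ) / ((m : ℝ) - 1)) := by
    have : (u ^ 2 + v ^ 2) = ‖(⟨u, v⟩ : ℂ)‖ ^ (2 : ℝ) := by
      rw [Real.rpow_two, Complex.sq_norm, Complex.normSq_apply]; ring
    rw [this, ← Real.rpow_mul (norm_nonneg _)]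
    congr 1; ring
  rw [FF, e]
  unfold hw
  generalize Real.cosh t ^ (-(1 : ℝ) / ((m : ℝ) - 1)) = a
  generalize (u ^ 2 + v ^ 2) ^ ((1 : ℝ) / ((m : ℝ) - 1)) = b
  generalize ((m : ℝ) - 2) / 2 = c
  apply Complex.ext
  · simp
  · simp; ring

lemma hasDerivAt_pair (u v : ℝ → ℝ) (a b t : ℝ) :
    HasDerivAt (fun t => (⟨u t, v t⟩ : ℂ)) ⟨a, b⟩ t ↔ HasDerivAt u a t ∧ HasDerivAt v b t := by
  constructor
  · intro h
    exact ⟨Complex.reCLM.hasFDerivAt.comp_hasDerivAt t h,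
      Complex.imCLM.hasFDerivAt.comp_hasDerivAt t h⟩
  · rintro ⟨h1, h2⟩
    have := h1.ofReal_comp.add (h2.ofReal_comp.mul_const Complex.I)
    have e1 : (fun t => (⟨u t, v t⟩ : ℂ)) =
        ((fun y => (u y : ℂ)) + fun y => (v y : ℂ) * Complex.I) := by
      funext s; apply Complex.ext <;> simp
    have e2 : (⟨a, b⟩ : ℂ) = a + b * Complex.I := by apply Complex.ext <;> simp
    rw [e1, e2]; exact this

lemma sol_iff (m : ℕ) (u v : ℝ → ℝ) : IsSolS2 m u v ↔
    ∀ t, HasDerivAt (fun t => (⟨u t, v t⟩ : ℂ))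
      (FF (((m : ℝ) - 2) / 2) (2 / ((m : ℝ) - 1)) (hw m) t ⟨u t, v t⟩) t := by
  simp only [FF_eq, hasDerivAt_pair]
  rfl

lemma sol_refl (m : ℕ) (u v : ℝ → ℝ) (h : IsSolS2 m u v) :
    IsSolS2 m (fun t => v (-t)) (fun t => u (-t)) := by
  intro t
  obtain ⟨h1, h2⟩ := h (-t)
  have h1' := h1.scomp t (hasDerivAt_neg t)
  have h2' := h2.scomp t (hasDerivAt_neg t)
  rw [Real.cosh_neg] at h1' h2'
  constructor
  · refine HasDerivAt.congr_deriv h2' ?_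
    simp only [smul_eq_mul]
    rw [add_comm (v (-t) ^ 2)]; ring
  · refine HasDerivAt.congr_deriv h1' ?_
    simp only [smul_eq_mul]
    rw [add_comm (v (-t) ^ 2)]; ring

theorem stmt7 (m : ℕ) (hm : 3 ≤ m) (μ : ℝ) (hμ : 0 < μ) :
    ∃ u v : ℝ → ℝ,
      (IsSolS2 m u v ∧ u 0 = μ ∧ v 0 = μ) ∧
      (∀ u' v' : ℝ → ℝ, IsSolS2 m u' v' → u' 0 = μ → v' 0 = μ → u' = u ∧ v' = v) ∧
      (∀ t : ℝ, u t = v (-t) ∧ v t = u (-t)) ∧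
      (∀ T : ℝ, 0 < T → ∀ ε : ℝ, 0 < ε → ∃ δ : ℝ, 0 < δ ∧
        ∀ μ' : ℝ, 0 < μ' → |μ' - μ| < δ →
          ∀ u' v' : ℝ → ℝ, IsSolS2 m u' v' → u' 0 = μ' → v' 0 = μ' →
            ∀ t ∈ Set.Icc (-T) T, |u' t - u t| < ε ∧ |v' t - v t| < ε) := by
  have hm' : (3 : ℝ) ≤ m := by exact_mod_cast hm
  have hc : 0 ≤ ((m : ℝ) - 2) / 2 := by linarith
  have hq : 0 < 2 / ((m : ℝ) - 1) := div_pos two_pos (by linarith)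
  have hq1 : 2 / ((m : ℝ) - 1) ≤ 1 := by rw [div_le_one (by linarith)]; linarith
  have hh : ∀ t, 0 ≤ hw m t ∧ hw m t ≤ 1 := fun t =>
    ⟨Real.rpow_nonneg (Real.cosh_pos t).le _,
      Real.rpow_le_one_of_one_le_of_nonpos (Real.one_le_cosh t)
        (div_nonpos_of_nonpos_of_nonneg (by norm_num) (by linarith))⟩
  have hcont : Continuous (hw m) :=
    Real.continuous_cosh.rpow_const fun t => Or.inl (Real.cosh_pos t).ne'
  obtain ⟨z, hz0, hz⟩ := global_exist _ _ (hw m) hc hq hq1 hh hcont ⟨μ, μ⟩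
  have hsol : IsSolS2 m (fun t => (z t).re) (fun t => (z t).im) := (sol_iff _ _ _).2 hz
  have huniq : ∀ u' v' : ℝ → ℝ, IsSolS2 m u' v' → u' 0 = μ → v' 0 = μ →
      u' = (fun t => (z t).re) ∧ v' = (fun t => (z t).im) := by
    intro u' v' hs hu hv
    have : ∀ t, (⟨u' t, v' t⟩ : ℂ) = z t := fun t =>
      uniq _ _ (hw m) hc hq hq1 hh (|t| + 1) (fun t => ⟨u' t, v' t⟩) z
        (fun s _ => (sol_iff _ _ _).1 hs s) (fun s _ => hz s) (by simp [hu, hv, hz0]) t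
        (by linarith)
    exact ⟨funext fun t => by rw [← this t], funext fun t => by rw [← this t]⟩
  refine ⟨fun t => (z t).re, fun t => (z t).im, ⟨hsol, by simp [hz0], by simp [hz0]⟩, huniq, ?_, ?_⟩
  · obtain ⟨h1, h2⟩ := huniq _ _ (sol_refl m _ _ hsol) (by simp [hz0]) (by simp [hz0])
    exact fun t => ⟨(congrFun h1 t).symm, (congrFun h2 t).symm⟩
  · intro T hT ε hε
    set C : ℝ := Real.exp ((2 * ((2 * (μ + 1)) * Real.exp (((m : ℝ) - 2) / 2 * (T + 1)))
      ^ (2 / ((m : ℝ) - 1)) + ((m : ℝ) - 2) / 2) * T) with hC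
    have hC0 : 0 < C := Real.exp_pos _
    refine ⟨min 1 (ε / (2 * C)), by positivity, ?_⟩
    intro μ' hμ' hd u' v' hs hu hv t ht
    have hd1 := hd.trans_le (min_le_left _ _)
    have hd2 := hd.trans_le (min_le_right _ _)
    have ht' : |t| ≤ T := abs_le.2 ht
    have hμ1 : μ' ≤ μ + 1 := by linarith [(abs_lt.1 hd1).2]
    have nb : ∀ x : ℝ, ‖(⟨x, x⟩ : ℂ)‖ ≤ 2 * |x| := fun x => by
      have := Complex.norm_le_abs_re_add_abs_im ⟨x, x⟩
      simp only at this
      linarith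
    have hdep := dep _ _ (hw m) hc hq hq1 hh (T + 1) (2 * (μ + 1)) (fun t => ⟨u' t, v' t⟩) z
      (fun s _ => (sol_iff _ _ _).1 hs s) (fun s _ => hz s)
      (by simp only [hu, hv]; have := nb μ'; rw [abs_of_pos hμ'] at this; linarith)
      (by rw [hz0]; have := nb μ; rw [abs_of_pos hμ] at this; linarith) t (by linarith)
    have h0 : ‖(⟨u' 0, v' 0⟩ : ℂ) - z 0‖ ≤ 2 * |μ' - μ| := by
      have : (⟨u' 0, v' 0⟩ : ℂ) - z 0 = ⟨μ' - μ, μ' - μ⟩ := by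
        rw [hz0, hu, hv]; apply Complex.ext <;> simp
      rw [this]; exact nb _
    have hfin : ‖(⟨u' t, v' t⟩ : ℂ) - z t‖ < ε := by
      calc _ ≤ _ := hdep
        _ ≤ (2 * |μ' - μ|) * C := by
            apply mul_le_mul h0 _ (Real.exp_pos _).le (by positivity)
            apply Real.exp_le_exp.2
            apply mul_le_mul_of_nonneg_left ht'
            positivity
        _ < ε := by
            rw [lt_div_iff₀ (by positivity)] at hd2
            linarith
    have hre := Complex.abs_re_le_norm ((⟨u' t, v' t⟩ : ℂ) - z t)
    have him := Complex.abs_im_le_norm ((⟨u' t, v' t⟩ : ℂ) - z t)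
    exact ⟨hre.trans_lt hfin, him.trans_lt hfin⟩
end
end

section
/- Let (u, v) be any C¹ solution of the system (S2) on ℝ and let h(t) = H(t, u(t), v(t)). Then h is differentiable with h'(t) = ((m-1)/(2m))·(d/dt)[cosh(t)^{−1/(m-1)}]·(u(t)² + v(t)²)^{m/(m-1)} = −(1/(2m))·cosh(t)^{−1/(m-1)}·tanh(t)·(u(t)² + v(t)²)^{m/(m-1)} for all t; in particular, h'(t) ≤ 0 for every t ≥ 0, so h is non-increasing on [0, +∞). -/
open Real Filter Set Topology

noncomputable section

theorem stmt8 (m : ℕ) (hm : 3 ≤ m) (u v : ℝ → ℝ) (hsol : IsSolS2 m u v) :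
    (∀ t : ℝ,
      HasDerivAt (fun s => H2 m s (u s) (v s))
        ((((m : ℝ) - 1) / (2 * (m : ℝ)))
          * deriv (fun s => Real.cosh s ^ (-(1 : ℝ) / ((m : ℝ) - 1))) t
          * ((u t) ^ 2 + (v t) ^ 2) ^ ((m : ℝ) / ((m : ℝ) - 1))) t ∧
      (((m : ℝ) - 1) / (2 * (m : ℝ)))
          * deriv (fun s => Real.cosh s ^ (-(1 : ℝ) / ((m : ℝ) - 1))) t
          * ((u t) ^ 2 + (v t) ^ 2) ^ ((m : ℝ) / ((m : ℝ) - 1))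
        = -(1 / (2 * (m : ℝ))) * Real.cosh t ^ (-(1 : ℝ) / ((m : ℝ) - 1))
          * Real.tanh t * ((u t) ^ 2 + (v t) ^ 2) ^ ((m : ℝ) / ((m : ℝ) - 1))) ∧
    (∀ t : ℝ, 0 ≤ t → deriv (fun s => H2 m s (u s) (v s)) t ≤ 0) ∧
    AntitoneOn (fun s => H2 m s (u s) (v s)) (Set.Ici 0) := by
  have hm' : (3 : ℝ) ≤ (m : ℝ) := by exact_mod_cast hm
  have hm0 : (m : ℝ) ≠ 0 := by linarith
  have hm1 : (m : ℝ) - 1 ≠ 0 := by linarith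
  have hp : (1 : ℝ) ≤ (m : ℝ) / ((m : ℝ) - 1) := by
    rw [le_div_iff₀ (by linarith)]; linarith
  have hpq : (m : ℝ) / ((m : ℝ) - 1) - 1 = 1 / ((m : ℝ) - 1) := by
    field_simp; ring
  have hC : ∀ t : ℝ, HasDerivAt (fun s => Real.cosh s ^ (-(1 : ℝ) / ((m : ℝ) - 1)))
      (Real.sinh t * (-(1 : ℝ) / ((m : ℝ) - 1))
        * Real.cosh t ^ (-(1 : ℝ) / ((m : ℝ) - 1) - 1)) t := fun t =>
    (Real.hasDerivAt_cosh t).rpow_const (Or.inl (Real.cosh_pos t).ne')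
  have h1 : ∀ t : ℝ, HasDerivAt (fun s => H2 m s (u s) (v s))
        ((((m : ℝ) - 1) / (2 * (m : ℝ)))
          * deriv (fun s => Real.cosh s ^ (-(1 : ℝ) / ((m : ℝ) - 1))) t
          * ((u t) ^ 2 + (v t) ^ 2) ^ ((m : ℝ) / ((m : ℝ) - 1))) t := by
    intro t
    obtain ⟨hu, hv⟩ := hsol t
    have hr := ((hu.pow 2).add (hv.pow 2)).rpow_const (p := (m : ℝ) / ((m : ℝ) - 1)) (Or.inr hp)
    have hD := (hC t).differentiableAt.hasDerivAt
    have := ((hu.const_mul (-(((m : ℝ) - 2) / 2))).mul hv).add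
      ((hD.const_mul (((m : ℝ) - 1) / (2 * (m : ℝ)))).mul hr)
    refine this.congr_deriv ?_
    simp only [Pi.add_apply, Pi.pow_apply, hpq]
    generalize deriv (fun s => Real.cosh s ^ (-(1 : ℝ) / ((m : ℝ) - 1))) t = D
    generalize Real.cosh t ^ (-(1 : ℝ) / ((m : ℝ) - 1)) = C
    generalize ((u t) ^ 2 + (v t) ^ 2) ^ ((m : ℝ) / ((m : ℝ) - 1)) = P
    generalize ((u t) ^ 2 + (v t) ^ 2) ^ ((1 : ℝ) / ((m : ℝ) - 1)) = Q
    field_simp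
    push_cast
    ring
  have h2 : ∀ t : ℝ, (((m : ℝ) - 1) / (2 * (m : ℝ)))
          * deriv (fun s => Real.cosh s ^ (-(1 : ℝ) / ((m : ℝ) - 1))) t
          * ((u t) ^ 2 + (v t) ^ 2) ^ ((m : ℝ) / ((m : ℝ) - 1))
        = -(1 / (2 * (m : ℝ))) * Real.cosh t ^ (-(1 : ℝ) / ((m : ℝ) - 1))
          * Real.tanh t * ((u t) ^ 2 + (v t) ^ 2) ^ ((m : ℝ) / ((m : ℝ) - 1)) := by
    intro t
    have hc := (Real.cosh_pos t).ne'
    rw [(hC t).deriv, Real.rpow_sub_one hc, Real.tanh_eq_sinh_div_cosh]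
    generalize Real.cosh t ^ (-(1 : ℝ) / ((m : ℝ) - 1)) = C
    generalize ((u t) ^ 2 + (v t) ^ 2) ^ ((m : ℝ) / ((m : ℝ) - 1)) = P
    field_simp
  have h3 : ∀ t : ℝ, 0 ≤ t → deriv (fun s => H2 m s (u s) (v s)) t ≤ 0 := by
    intro t ht
    rw [(h1 t).deriv, h2 t]
    have hT : 0 ≤ Real.tanh t := by
      rw [Real.tanh_eq_sinh_div_cosh]
      exact div_nonneg (Real.sinh_nonneg_iff.2 ht) (Real.cosh_pos t).le
    have hCp : 0 ≤ Real.cosh t ^ (-(1 : ℝ) / ((m : ℝ) - 1)) :=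
      Real.rpow_nonneg (Real.cosh_pos t).le _
    have hP : 0 ≤ ((u t) ^ 2 + (v t) ^ 2) ^ ((m : ℝ) / ((m : ℝ) - 1)) :=
      Real.rpow_nonneg (by positivity) _
    have hM : 0 ≤ 1 / (2 * (m : ℝ)) := by positivity
    have := mul_nonneg (mul_nonneg (mul_nonneg hM hCp) hT) hP
    linarith
  refine ⟨fun t => ⟨h1 t, h2 t⟩, h3, ?_⟩
  refine antitoneOn_of_deriv_nonpos (convex_Ici 0)
    (fun t _ => (h1 t).continuousAt.continuousWithinAt)
    (fun t _ => (h1 t).differentiableAt.differentiableWithinAt) ?_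
  intro t ht
  exact h3 t (interior_subset ht)
end
end

section
/- Fix μ > 0 and let (u_μ, v_μ) be the solution of (S2) with u_μ(0) = v_μ(0) = μ. If u_μ(t₀) = 0 for some t₀ ≠ 0, then v_μ(t₀) ≠ 0 and u_μ'(t₀) ≠ 0; if v_μ(t₀) = 0 for some t₀ > 0, then u_μ(t₀) ≠ 0 and v_μ'(t₀) ≠ 0. Moreover, for every T > 0, neither u_μ nor v_μ changes sign infinitely many times on the interval [−T, T]. -/
open Real Filter Set Topology

noncomputable section

/-- `w` changes sign at least `k` times on `J`. -/
def ChangesSignAtLeast (w : ℝ → ℝ) (J : Set ℝ) (k : ℕ) : Prop :=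
  ∃ s : ℕ → ℝ, (∀ i, i ≤ k → s i ∈ J) ∧
    (∀ i j, i < j → j ≤ k → s i < s j) ∧
    (∀ i, i + 1 ≤ k → w (s i) * w (s (i + 1)) < 0)

/-- `w` changes sign exactly `k` times on `J`. -/
def ChangesSignExactly (w : ℝ → ℝ) (J : Set ℝ) (k : ℕ) : Prop :=
  ChangesSignAtLeast w J k ∧ ¬ ChangesSignAtLeast w J (k + 1)

theorem aux_N_pos (m : ℕ) (hm : 3 ≤ m) (u v : ℝ → ℝ) (hsol : IsSolS2 m u v)
    (h0 : 0 < u 0 ^ 2 + v 0 ^ 2) (t : ℝ) : 0 < u t ^ 2 + v t ^ 2 := by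
  have hm' : (3 : ℝ) ≤ m := by exact_mod_cast hm
  set a : ℝ := (((m : ℝ) - 2) / 2) with ha
  have hapos : 0 ≤ a := by rw [ha]; linarith
  have hN : ∀ t, HasDerivAt (fun t => u t ^ 2 + v t ^ 2) (2 * a * (v t ^ 2 - u t ^ 2)) t := by
    intro t
    obtain ⟨h1, h2⟩ := hsol t
    refine ((h1.pow 2).add (h2.pow 2)).congr_deriv ?_
    rw [← ha]
    push_cast
    ring
  have hE : ∀ (b t : ℝ), HasDerivAt (fun t => (u t ^ 2 + v t ^ 2) * Real.exp (b * t))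
      ((2 * a * (v t ^ 2 - u t ^ 2) + b * (u t ^ 2 + v t ^ 2)) * Real.exp (b * t)) t := by
    intro b t
    have he : HasDerivAt (fun t => Real.exp (b * t)) (Real.exp (b * t) * (b * 1)) t :=
      ((hasDerivAt_id t).const_mul b).exp
    refine ((hN t).mul he).congr_deriv ?_
    ring
  rcases le_total 0 t with ht | ht
  · have hmono : Monotone (fun t => (u t ^ 2 + v t ^ 2) * Real.exp (2 * a * t)) := by
      refine monotone_of_deriv_nonneg (fun t => (hE _ t).differentiableAt) (fun t => ?_)
      rw [(hE _ t).deriv]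
      refine mul_nonneg ?_ (Real.exp_pos _).le
      have := mul_nonneg hapos (sq_nonneg (v t))
      nlinarith
    have := hmono ht
    simp only [mul_zero, Real.exp_zero, mul_one] at this
    exact pos_of_mul_pos_left (h0.trans_le this) (Real.exp_pos _).le
  · have hmono : Antitone (fun t => (u t ^ 2 + v t ^ 2) * Real.exp (-(2 * a) * t)) := by
      refine antitone_of_deriv_nonpos (fun t => (hE _ t).differentiableAt) (fun t => ?_)
      rw [(hE _ t).deriv]
      refine mul_nonpos_of_nonpos_of_nonneg ?_ (Real.exp_pos _).le
      have := mul_nonneg hapos (sq_nonneg (u t))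
      nlinarith
    have := hmono ht
    simp only [mul_zero, Real.exp_zero, mul_one] at this
    exact pos_of_mul_pos_left (h0.trans_le this) (Real.exp_pos _).le

theorem aux_finite (w w' : ℝ → ℝ) (hw : ∀ t, HasDerivAt w (w' t) t)
    (hz : ∀ t, w t = 0 → w' t ≠ 0) (T : ℝ) : ({t | t ∈ Icc (-T) T ∧ w t = 0}).Finite := by
  by_contra hinf
  obtain ⟨x, -, hx⟩ := Set.Infinite.exists_accPt_of_subset_isCompact hinf
    (isCompact_Icc (a := -T) (b := T)) (fun t ht => ht.1)
  have hfreq := accPt_iff_frequently_nhdsNE.1 hx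
  have hcont : Continuous w := continuous_iff_continuousAt.2 fun t => (hw t).continuousAt
  have hx0 : w x = 0 := by
    have hcl : IsClosed {t | w t = 0} := isClosed_eq hcont continuous_const
    have : ∃ᶠ y in 𝓝 x, y ∈ {t | w t = 0} :=
      (hfreq.filter_mono nhdsWithin_le_nhds).mono fun y hy => hy.2
    exact hcl.mem_of_frequently_of_tendsto this tendsto_id
  have := (hw x).eventually_ne (c := 0) (hz x hx0)
  exact hfreq (this.mono fun y hy h => hy h.2)

theorem aux_sign (w : ℝ → ℝ) (hcont : Continuous w) (T : ℝ)
    (hfin : ({t | t ∈ Icc (-T) T ∧ w t = 0}).Finite) :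
    ∃ k : ℕ, ¬ ChangesSignAtLeast w (Set.Icc (-T) T) k := by
  refine ⟨hfin.toFinset.card + 1, ?_⟩
  rintro ⟨s, hs, hlt, hsgn⟩
  set k := hfin.toFinset.card + 1 with hk
  have hex : ∀ i, i + 1 ≤ k → ∃ z ∈ Ioo (s i) (s (i + 1)), w z = 0 := by
    intro i hi
    have h1 := hlt i (i + 1) (Nat.lt_succ_self i) hi
    have h2 := hsgn i hi
    rcases mul_neg_iff.1 h2 with ⟨p, q⟩ | ⟨p, q⟩
    · exact intermediate_value_Ioo' h1.le hcont.continuousOn ⟨q, p⟩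
    · exact intermediate_value_Ioo h1.le hcont.continuousOn ⟨p, q⟩
  choose! z hz hz0 using hex
  have hmaps : ∀ i ∈ Finset.range k, z i ∈ hfin.toFinset := by
    intro i hi
    have hi' : i + 1 ≤ k := Finset.mem_range.1 hi
    have h := hz i hi'
    rw [Set.Finite.mem_toFinset]
    exact ⟨⟨(hs i (by omega)).1.trans h.1.le, h.2.le.trans (hs _ hi').2⟩, hz0 i hi'⟩
  have hmono : ∀ i j, i < j → j + 1 ≤ k → z i < z j := by
    intro i j hij hj
    have h1 := (hz i (by omega)).2
    have h2 := (hz j hj).1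
    have h3 : s (i + 1) ≤ s j := by
      rcases Nat.lt_or_ge (i + 1) j with h | h
      · exact (hlt _ _ h (by omega)).le
      · have : i + 1 = j := by omega
        rw [this]
    linarith
  have := Finset.card_le_card_of_injOn z hmaps (by
    intro i hi j hj hij
    have hi' : i + 1 ≤ k := Finset.mem_range.1 hi
    have hj' : j + 1 ≤ k := Finset.mem_range.1 hj
    rcases Nat.lt_trichotomy i j with h | h | h
    · exact absurd hij (hmono i j h hj').ne
    · exact h
    · exact absurd hij (hmono j i h hi').ne')
  rw [Finset.card_range] at this
  omega

theorem stmt9 (m : ℕ) (hm : 3 ≤ m) (μ : ℝ) (hμ : 0 < μ)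
    (u v : ℝ → ℝ) (hsol : IsSolS2 m u v) (hu0 : u 0 = μ) (hv0 : v 0 = μ) :
    (∀ t₀ : ℝ, t₀ ≠ 0 → u t₀ = 0 → v t₀ ≠ 0 ∧ deriv u t₀ ≠ 0) ∧
    (∀ t₀ : ℝ, 0 < t₀ → v t₀ = 0 → u t₀ ≠ 0 ∧ deriv v t₀ ≠ 0) ∧
    (∀ T : ℝ, 0 < T →
      (∃ k : ℕ, ¬ ChangesSignAtLeast u (Set.Icc (-T) T) k) ∧
      (∃ k : ℕ, ¬ ChangesSignAtLeast v (Set.Icc (-T) T) k)) := by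
  have hN := aux_N_pos m hm u v hsol (by rw [hu0, hv0]; positivity)
  have hg : ∀ t, 0 < Real.cosh t ^ (-(1 : ℝ) / ((m : ℝ) - 1))
        * ((u t) ^ 2 + (v t) ^ 2) ^ ((1 : ℝ) / ((m : ℝ) - 1)) := fun t =>
    mul_pos (Real.rpow_pos_of_pos (Real.cosh_pos t) _) (Real.rpow_pos_of_pos (hN t) _)
  have hu : ∀ t, u t = 0 → v t ≠ 0 ∧ deriv u t ≠ 0 := by
    intro t ht
    have hv : v t ≠ 0 := by
      intro h
      have := hN t
      rw [ht, h] at this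
      norm_num at this
    refine ⟨hv, ?_⟩
    rw [(hsol t).1.deriv]
    have := mul_ne_zero (hg t).ne' hv
    intro h
    apply this
    linear_combination h + (((m : ℝ) - 2) / 2) * ht
  have hv : ∀ t, v t = 0 → u t ≠ 0 ∧ deriv v t ≠ 0 := by
    intro t ht
    have hv : u t ≠ 0 := by
      intro h
      have := hN t
      rw [ht, h] at this
      norm_num at this
    refine ⟨hv, ?_⟩
    rw [(hsol t).2.deriv]
    have := mul_ne_zero (hg t).ne' hv
    intro h
    apply this
    linear_combination -h + (((m : ℝ) - 2) / 2) * ht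
  have du : Differentiable ℝ u := fun t => (hsol t).1.differentiableAt
  have dv : Differentiable ℝ v := fun t => (hsol t).2.differentiableAt
  refine ⟨fun t _ h => hu t h, fun t _ h => hv t h, fun T _ => ⟨?_, ?_⟩⟩
  · exact aux_sign u du.continuous T
      (aux_finite u (deriv u) (fun t => (du t).hasDerivAt) (fun t h => (hu t h).2) T)
  · exact aux_sign v dv.continuous T
      (aux_finite v (deriv v) (fun t => (dv t).hasDerivAt) (fun t h => (hv t h).2) T)
end
end

section
/- Fix μ > 0 and let (u_μ, v_μ) be the solution of (S2) with u_μ(0) = v_μ(0) = μ. If (u_μ, v_μ) is bounded, i.e. there exists M > 0 with |u_μ(t)| + |v_μ(t)| ≤ M for all t ∈ ℝ, then (u_μ(t), v_μ(t)) → (0, 0) as |t| → +∞. -/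
open Real Filter Set Topology

noncomputable section

lemma auxA (a : ℝ) (ha : 0 < a) (f g : ℝ → ℝ) (hf : ∀ t, HasDerivAt f (g t - a * f t) t)
    (hg : Tendsto g atTop (𝓝 0)) (ε : ℝ) (hε : 0 < ε) : ∀ᶠ t in atTop, f t < ε := by
  have h1 : ∀ᶠ t in atTop, g t < a * (ε / 2) := hg.eventually_lt_const (by positivity)
  obtain ⟨T, hT⟩ := eventually_atTop.1 h1
  have hd : ∀ t, HasDerivAt (fun t => (f t - ε / 2) * Real.exp (a * t))
      ((g t - a * f t) * Real.exp (a * t) + (f t - ε / 2) * (Real.exp (a * t) * (a * 1))) t := by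
    intro t
    exact ((hf t).sub_const (ε / 2)).mul (((hasDerivAt_id t).const_mul a).exp)
  have hanti : AntitoneOn (fun t => (f t - ε / 2) * Real.exp (a * t)) (Ici T) := by
    apply antitoneOn_of_deriv_nonpos (convex_Ici T)
    · exact fun t _ => (hd t).continuousAt.continuousWithinAt
    · exact fun t _ => (hd t).differentiableAt.differentiableWithinAt
    · intro t ht
      rw [interior_Ici] at ht
      rw [(hd t).deriv]
      have := hT t (le_of_lt ht)
      have e := Real.exp_pos (a * t)
      nlinarith
  have hlim : Tendsto (fun t => (f T - ε / 2) * Real.exp (a * T) * Real.exp (-(a * t)))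
      atTop (𝓝 ((f T - ε / 2) * Real.exp (a * T) * 0)) := by
    apply Tendsto.const_mul
    exact Real.tendsto_exp_neg_atTop_nhds_zero.comp (tendsto_id.const_mul_atTop ha)
  rw [mul_zero] at hlim
  filter_upwards [hlim.eventually_lt_const (half_pos hε), eventually_ge_atTop T] with t h2 h3
  have h4 := hanti (mem_Ici.2 le_rfl) (mem_Ici.2 h3) h3
  simp only at h4
  have h5 := mul_le_mul_of_nonneg_right h4 (Real.exp_pos (-(a * t))).le
  rw [mul_assoc (f t - ε / 2), ← Real.exp_add, add_neg_cancel, Real.exp_zero] at h5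
  linarith

lemma auxB (a : ℝ) (ha : 0 < a) (f g : ℝ → ℝ) (hf : ∀ t, HasDerivAt f (a * f t - g t) t)
    (hg : Tendsto g atTop (𝓝 0)) (M : ℝ) (hM : ∀ t, |f t| ≤ M)
    (ε : ℝ) (hε : 0 < ε) : ∀ᶠ t in atTop, f t < ε := by
  have h1 : ∀ᶠ t in atTop, g t < a * (ε / 2) := hg.eventually_lt_const (by positivity)
  obtain ⟨T, hT⟩ := eventually_atTop.1 h1
  have hd : ∀ t, HasDerivAt (fun t => (f t - ε / 2) * Real.exp (-a * t))
      ((a * f t - g t) * Real.exp (-a * t)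
        + (f t - ε / 2) * (Real.exp (-a * t) * (-a * 1))) t := by
    intro t
    exact ((hf t).sub_const (ε / 2)).mul (((hasDerivAt_id t).const_mul (-a)).exp)
  have hmono : MonotoneOn (fun t => (f t - ε / 2) * Real.exp (-a * t)) (Ici T) := by
    apply monotoneOn_of_deriv_nonneg (convex_Ici T)
    · exact fun t _ => (hd t).continuousAt.continuousWithinAt
    · exact fun t _ => (hd t).differentiableAt.differentiableWithinAt
    · intro t ht
      rw [interior_Ici] at ht
      rw [(hd t).deriv]
      have := hT t (le_of_lt ht)
      have e := Real.exp_pos (-a * t)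
      nlinarith
  have hlim : Tendsto (fun t => M * Real.exp (-a * t)) atTop (𝓝 (M * 0)) := by
    apply Tendsto.const_mul
    have := Real.tendsto_exp_neg_atTop_nhds_zero.comp
      ((tendsto_id (α := ℝ)).const_mul_atTop ha)
    refine this.congr fun t => ?_
    simp
  rw [mul_zero] at hlim
  filter_upwards [eventually_ge_atTop T] with t ht
  have h6 : (f t - ε / 2) * Real.exp (-a * t) ≤ 0 := by
    refine ge_of_tendsto hlim ?_
    filter_upwards [eventually_ge_atTop t] with s hs
    have h4 := hmono (mem_Ici.2 ht) (mem_Ici.2 (ht.trans hs)) hs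
    simp only at h4
    refine h4.trans ?_
    have := (abs_le.1 (hM s)).2
    exact mul_le_mul_of_nonneg_right (by linarith) (Real.exp_pos _).le
  have e := Real.exp_pos (-a * t)
  by_contra hc
  push Not at hc
  nlinarith [mul_pos (by linarith : 0 < f t - ε / 2) e]

lemma auxT (f : ℝ → ℝ) (h1 : ∀ ε > 0, ∀ᶠ t in atTop, f t < ε)
    (h2 : ∀ ε > 0, ∀ᶠ t in atTop, -f t < ε) : Tendsto f atTop (𝓝 0) := by
  rw [Metric.tendsto_nhds]
  intro ε hε
  filter_upwards [h1 ε hε, h2 ε hε] with t a b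
  rw [Real.dist_eq, sub_zero, abs_lt]
  constructor <;> linarith

lemma auxA2 (a : ℝ) (ha : 0 < a) (f g : ℝ → ℝ) (hf : ∀ t, HasDerivAt f (g t - a * f t) t)
    (hg : Tendsto g atTop (𝓝 0)) : Tendsto f atTop (𝓝 0) := by
  refine auxT f (auxA a ha f g hf hg) (auxA a ha (fun t => - f t) (fun t => - g t) ?_ ?_)
  · intro t
    exact (hf t).fun_neg.congr_deriv (by ring)
  · simpa using hg.neg

lemma auxB2 (a : ℝ) (ha : 0 < a) (f g : ℝ → ℝ) (hf : ∀ t, HasDerivAt f (a * f t - g t) t)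
    (hg : Tendsto g atTop (𝓝 0)) (M : ℝ) (hM : ∀ t, |f t| ≤ M) : Tendsto f atTop (𝓝 0) := by
  refine auxT f (auxB a ha f g hf hg M hM)
    (auxB a ha (fun t => - f t) (fun t => - g t) ?_ ?_ M ?_)
  · intro t
    exact (hf t).fun_neg.congr_deriv (by ring)
  · simpa using hg.neg
  · simpa using hM

lemma auxG (p q M : ℝ) (hp : 0 < p) (hq : 0 ≤ q) (x y w : ℝ → ℝ)
    (hb : ∀ t, |x t| + |y t| ≤ M) (hw : ∀ t, |w t| ≤ M) :
    Tendsto (fun t => Real.cosh t ^ (-p) * (x t ^ 2 + y t ^ 2) ^ q * w t) atTop (𝓝 0) := by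
  have hc : Tendsto Real.cosh atTop atTop := by
    refine tendsto_atTop_mono (f := fun t => Real.exp t / 2) (fun t => ?_)
      (Real.tendsto_exp_atTop.atTop_div_const (by norm_num))
    rw [Real.cosh_eq]
    have := Real.exp_pos (-t)
    linarith
  have hl := ((tendsto_rpow_neg_atTop hp).comp hc).mul_const ((M ^ 2) ^ q * M)
  rw [zero_mul] at hl
  refine squeeze_zero_norm (fun t => ?_) hl
  have h0 : 0 ≤ x t ^ 2 + y t ^ 2 := by positivity
  have h1 : x t ^ 2 + y t ^ 2 ≤ M ^ 2 := by
    have := hb t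
    rw [← sq_abs (x t), ← sq_abs (y t)]
    nlinarith [abs_nonneg (x t), abs_nonneg (y t),
      mul_nonneg (abs_nonneg (x t)) (abs_nonneg (y t))]
  have h2 := Real.rpow_le_rpow h0 h1 hq
  have hcp : 0 ≤ Real.cosh t ^ (-p) := Real.rpow_nonneg (Real.cosh_pos t).le _
  rw [Real.norm_eq_abs, abs_mul, abs_mul, abs_of_nonneg hcp,
    abs_of_nonneg (Real.rpow_nonneg h0 q), mul_assoc]
  exact mul_le_mul_of_nonneg_left
    (mul_le_mul h2 (hw t) (abs_nonneg _) (Real.rpow_nonneg (sq_nonneg M) q)) hcp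

theorem stmt10 (m : ℕ) (hm : 3 ≤ m) (μ : ℝ) (hμ : 0 < μ)
    (u v : ℝ → ℝ) (hsol : IsSolS2 m u v) (hu0 : u 0 = μ) (hv0 : v 0 = μ)
    (M : ℝ) (hM : 0 < M) (hbdd : ∀ t : ℝ, |u t| + |v t| ≤ M) :
    Tendsto u atTop (𝓝 0) ∧ Tendsto u atBot (𝓝 0) ∧
    Tendsto v atTop (𝓝 0) ∧ Tendsto v atBot (𝓝 0) := by
  have hm' : (3 : ℝ) ≤ m := by exact_mod_cast hm
  have ha : 0 < ((m : ℝ) - 2) / 2 := by linarith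
  have hp : 0 < (1 : ℝ) / ((m : ℝ) - 1) := by
    apply div_pos <;> linarith
  have hu : ∀ t, |u t| ≤ M := fun t => by linarith [hbdd t, abs_nonneg (v t)]
  have hv : ∀ t, |v t| ≤ M := fun t => by linarith [hbdd t, abs_nonneg (u t)]
  unfold IsSolS2 at hsol
  rw [neg_div] at hsol
  have key : ∀ f : ℝ → ℝ, Tendsto (fun t => f (-t)) atTop (𝓝 0) → Tendsto f atBot (𝓝 0) := by
    intro f hf
    simpa [Function.comp_def] using hf.comp tendsto_neg_atBot_atTop
  have rev : ∀ (f : ℝ → ℝ) (d t : ℝ), HasDerivAt f d (-t) →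
      HasDerivAt (fun s => f (-s)) (-d) t := by
    intro f d t h
    have := h.comp t (hasDerivAt_neg t)
    simpa [Function.comp_def] using this
  refine ⟨?_, key _ ?_, ?_, key _ ?_⟩
  · exact auxA2 _ ha u _ (fun t => (hsol t).1) (auxG _ _ M hp hp.le u v v hbdd hv)
  · refine auxB2 _ ha (fun t => u (-t)) _ (fun t => ?_)
      (auxG _ _ M hp hp.le (fun t => u (-t)) (fun t => v (-t)) (fun t => v (-t))
        (fun t => hbdd (-t)) (fun t => hv (-t))) M (fun t => hu (-t))
    refine (rev u _ t (hsol (-t)).1).congr_deriv ?_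
    rw [Real.cosh_neg]
    ring
  · exact auxB2 _ ha v _ (fun t => (hsol t).2) (auxG _ _ M hp hp.le u v u hbdd hu) M hv
  · refine auxA2 _ ha (fun t => v (-t)) _ (fun t => ?_)
      (auxG _ _ M hp hp.le (fun t => u (-t)) (fun t => v (-t)) (fun t => u (-t))
        (fun t => hbdd (-t)) (fun t => hu (-t)))
    refine (rev v _ t (hsol (-t)).2).congr_deriv ?_
    rw [Real.cosh_neg]
    ring
end
end

section
/- Fix μ > 0 and let (u_μ, v_μ) be the solution of (S2) with u_μ(0) = v_μ(0) = μ, and H_μ(t) = H(t, u_μ(t), v_μ(t)). If lim_{|t|→+∞} H_μ(t) ∈ [−∞, 0), then there exist C > 0 and T > 0 such that u_μ(t)² + v_μ(t)² ≤ C·cosh(t) for all |t| ≥ T. -/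
open Real Filter Set Topology

noncomputable section

theorem H2_neg_bound (m : ℕ) (hm : 3 ≤ m) (t x y : ℝ) (h : H2 m t x y < 0) :
    x ^ 2 + y ^ 2 ≤
      ((((m : ℝ) - 2) / 2) * m / ((m : ℝ) - 1)) ^ ((m : ℝ) - 1) * Real.cosh t := by
  have hm' : (3 : ℝ) ≤ m := by exact_mod_cast hm
  have hq : (0 : ℝ) < (m : ℝ) - 1 := by linarith
  have hc : 0 < Real.cosh t := Real.cosh_pos t
  have hKpos : 0 < (((m : ℝ) - 2) / 2) * m / ((m : ℝ) - 1) := by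
    apply div_pos _ hq
    apply mul_pos <;> linarith
  have hxy : 2 * (x * y) ≤ x ^ 2 + y ^ 2 := by nlinarith [sq_nonneg (x - y)]
  have hr0 : 0 ≤ x ^ 2 + y ^ 2 := by positivity
  unfold H2 at h
  set r := x ^ 2 + y ^ 2 with hr
  rcases hr0.eq_or_lt with h0 | hrpos
  · rw [← h0]; positivity
  have e1 : r ^ ((m : ℝ) / ((m : ℝ) - 1)) = r * r ^ ((1 : ℝ) / ((m : ℝ) - 1)) := by
    have : (m : ℝ) / ((m : ℝ) - 1) = 1 + 1 / ((m : ℝ) - 1) := by field_simp; ring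
    rw [this, Real.rpow_add hrpos, Real.rpow_one]
  have e2 : Real.cosh t ^ (-(1 : ℝ) / ((m : ℝ) - 1))
      = (Real.cosh t ^ ((1 : ℝ) / ((m : ℝ) - 1)))⁻¹ := by
    rw [neg_div, Real.rpow_neg hc.le]
  rw [e1, e2] at h
  have hd : 0 < Real.cosh t ^ ((1 : ℝ) / ((m : ℝ) - 1)) := Real.rpow_pos_of_pos hc _
  have hR : (r ^ ((1 : ℝ) / ((m : ℝ) - 1))) ^ ((m : ℝ) - 1) = r := by
    rw [← Real.rpow_mul hrpos.le, one_div_mul_cancel hq.ne', Real.rpow_one]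
  have hD : (Real.cosh t ^ ((1 : ℝ) / ((m : ℝ) - 1))) ^ ((m : ℝ) - 1) = Real.cosh t := by
    rw [← Real.rpow_mul hc.le, one_div_mul_cancel hq.ne', Real.rpow_one]
  have hs0 : 0 ≤ r ^ ((1 : ℝ) / ((m : ℝ) - 1)) := Real.rpow_nonneg hrpos.le _
  set s := r ^ ((1 : ℝ) / ((m : ℝ) - 1))
  set d := Real.cosh t ^ ((1 : ℝ) / ((m : ℝ) - 1))
  set K := (((m : ℝ) - 2) / 2) * m / ((m : ℝ) - 1) with hK
  have key : s ≤ K * d := by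
    have h1 : r * ((((m : ℝ) - 1) / (2 * m)) * d⁻¹ * s) < r * (((m : ℝ) - 2) / 2 / 2) := by
      have : (((m : ℝ) - 2) / 2) * (2 * (x * y)) ≤ (((m : ℝ) - 2) / 2) * r :=
        mul_le_mul_of_nonneg_left hxy (by linarith)
      linarith
    have h2 := lt_of_mul_lt_mul_left h1 hrpos.le
    have h3 : s = (2 * m / ((m : ℝ) - 1) * d) * ((((m : ℝ) - 1) / (2 * m)) * d⁻¹ * s) := by
      field_simp
    have h4 : K * d = (2 * m / ((m : ℝ) - 1) * d) * (((m : ℝ) - 2) / 2 / 2) := by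
      rw [hK]; field_simp
    rw [h3, h4]
    exact mul_le_mul_of_nonneg_left h2.le (by positivity)
  calc r = s ^ ((m : ℝ) - 1) := hR.symm
    _ ≤ (K * d) ^ ((m : ℝ) - 1) := Real.rpow_le_rpow hs0 key hq.le
    _ = K ^ ((m : ℝ) - 1) * Real.cosh t := by
      rw [Real.mul_rpow hKpos.le hd.le, hD]

theorem stmt11 (m : ℕ) (hm : 3 ≤ m) (μ : ℝ) (hμ : 0 < μ)
    (u v : ℝ → ℝ) (hsol : IsSolS2 m u v) (hu0 : u 0 = μ) (hv0 : v 0 = μ)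
    (hlim :
      (∃ L : ℝ, L < 0 ∧
        Tendsto (fun t => H2 m t (u t) (v t)) atTop (𝓝 L) ∧
        Tendsto (fun t => H2 m t (u t) (v t)) atBot (𝓝 L)) ∨
      (Tendsto (fun t => H2 m t (u t) (v t)) atTop atBot ∧
        Tendsto (fun t => H2 m t (u t) (v t)) atBot atBot)) :
    ∃ C T : ℝ, 0 < C ∧ 0 < T ∧
      ∀ t : ℝ, T ≤ |t| → (u t) ^ 2 + (v t) ^ 2 ≤ C * Real.cosh t := by
  have hm' : (3 : ℝ) ≤ m := by exact_mod_cast hm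
  have hev : (∀ᶠ t in atTop, H2 m t (u t) (v t) < 0) ∧
      (∀ᶠ t in atBot, H2 m t (u t) (v t) < 0) := by
    rcases hlim with ⟨L, hL, h1, h2⟩ | ⟨h1, h2⟩
    · exact ⟨h1.eventually_lt_const hL, h2.eventually_lt_const hL⟩
    · exact ⟨h1.eventually_lt_atBot 0, h2.eventually_lt_atBot 0⟩
  obtain ⟨A, hA⟩ := eventually_atTop.1 hev.1
  obtain ⟨B, hB⟩ := eventually_atBot.1 hev.2
  refine ⟨((((m : ℝ) - 2) / 2) * m / ((m : ℝ) - 1)) ^ ((m : ℝ) - 1), max 1 (max A (-B)),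
    ?_, by positivity, ?_⟩
  · apply Real.rpow_pos_of_pos
    apply div_pos _ (by linarith)
    apply mul_pos <;> linarith
  · intro t ht
    apply H2_neg_bound m hm
    have h1 : A ≤ |t| := le_trans (le_trans (le_max_left _ _) (le_max_right _ _)) ht
    have h2 : -B ≤ |t| := le_trans (le_trans (le_max_right _ _) (le_max_right _ _)) ht
    rcases abs_cases t with ⟨h, _⟩ | ⟨h, _⟩
    · exact hA t (by linarith)
    · exact hB t (by linarith)
end
end

section
/- Let μ > 0 and let (u_μ, v_μ) be the solution of (S2) with u_μ(0) = v_μ(0) = μ. If v_μ changes sign only a finite number of times on ℝ, then there exists T > 0 such that u_μ(t)·v_μ(t) > 0 for all |t| ≥ T. -/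
open Real Filter Set Topology

noncomputable section

/-- Abstract structure of forward solutions. -/
structure GoodS (a : ℝ) (G u v : ℝ → ℝ) : Prop where
  ha : 0 < a
  hG : ∀ t, 0 ≤ t → 0 < G t
  hr : ∀ t, 0 ≤ t → 0 < u t ^ 2 + v t ^ 2
  hu : ∀ t, HasDerivAt u (G t * v t - a * u t) t
  hv : ∀ t, HasDerivAt v (a * v t - G t * u t) t
  hgr : ∀ c, 0 < c → ∃ d, 0 < d ∧ ∀ t, 0 ≤ t → c * Real.exp (a * t) ≤ |v t| → d ≤ G t

theorem GoodS.neg {a : ℝ} {G u v : ℝ → ℝ} (h : GoodS a G u v) :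
    GoodS a G (fun t => - u t) (fun t => - v t) := by
  refine ⟨h.ha, h.hG, fun t ht => by simpa using h.hr t ht, fun t => ?_, fun t => ?_, ?_⟩
  · exact (h.hu t).neg.congr_deriv (by ring)
  · exact (h.hv t).neg.congr_deriv (by ring)
  · intro c hc
    obtain ⟨d, hd, hh⟩ := h.hgr c hc
    exact ⟨d, hd, fun t ht h' => hh t ht (by simpa using h')⟩

theorem mono_of_hasDeriv {f f' : ℝ → ℝ} {T : ℝ} (hf : ∀ t, HasDerivAt f (f' t) t)
    (h : ∀ t, T ≤ t → 0 ≤ f' t) : ∀ t, T ≤ t → f T ≤ f t := by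
  have : MonotoneOn f (Set.Ici T) := by
    apply monotoneOn_of_deriv_nonneg (convex_Ici T)
    · exact fun t _ => (hf t).continuousAt.continuousWithinAt
    · exact fun t _ => (hf t).differentiableAt.differentiableWithinAt
    · intro t ht
      rw [interior_Ici] at ht
      rw [(hf t).deriv]
      exact h t (le_of_lt ht)
  intro t ht
  exact this (Set.mem_Ici.2 le_rfl) ht ht

theorem pos_stays {f f' : ℝ → ℝ} {T : ℝ} (hf : ∀ t, HasDerivAt f (f' t) t)
    (h0 : 0 < f T) (h : ∀ t, T ≤ t → f t = 0 → 0 < f' t) : ∀ t, T ≤ t → 0 < f t := by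
  intro t ht
  by_contra hneg
  push Not at hneg
  have hc : Continuous f := continuous_iff_continuousAt.2 fun t => (hf t).continuousAt
  let S := Set.Icc T t ∩ {s | f s ≤ 0}
  have hS : IsCompact S :=
    isCompact_Icc.inter_right (isClosed_le hc continuous_const)
  obtain ⟨s, hs⟩ := hS.exists_isLeast ⟨t, ⟨ht, le_rfl⟩, hneg⟩
  have hsT : T < s := by
    rcases lt_or_eq_of_le hs.1.1.1 with h1 | h1
    · exact h1
    · have := hs.1.2
      simp only [Set.mem_ofPred_eq] at this
      rw [← h1] at this
      linarith
  have hlt : ∀ r, T ≤ r → r < s → 0 < f r := by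
    intro r hr hrs
    by_contra hcon
    push Not at hcon
    have : s ≤ r := hs.2 ⟨⟨hr, by linarith [hs.1.1.2]⟩, hcon⟩
    linarith
  have hev : ∀ᶠ r in 𝓝[<] s, 0 < f r := by
    filter_upwards [Ioo_mem_nhdsLT hsT] with r hr
    exact hlt r hr.1.le hr.2
  have hs0 : f s = 0 := by
    apply le_antisymm hs.1.2
    have htd : Tendsto f (𝓝[<] s) (𝓝 (f s)) := (hc.tendsto s).mono_left nhdsWithin_le_nhds
    apply ge_of_tendsto htd
    exact hev.mono fun r hr => hr.le
  have hd := h s hsT.le hs0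
  have hsl := (hasDerivAt_iff_tendsto_slope.1 (hf s)).mono_left
    (nhdsWithin_mono s (fun x (hx : x < s) => ne_of_lt hx) : 𝓝[<] s ≤ 𝓝[≠] s)
  have h1 := hsl.eventually (lt_mem_nhds hd)
  obtain ⟨r, hr1, hr2, hr3⟩ := (h1.and (hev.and self_mem_nhdsWithin)).exists
  rw [slope_def_field, hs0] at hr1
  have hr3' : r < s := hr3
  have : (f r - 0) / (r - s) < 0 := div_neg_of_pos_of_neg (by linarith) (by linarith)
  linarith

theorem GoodS.noK {a : ℝ} {G u v : ℝ → ℝ} (h : GoodS a G u v) {T : ℝ} (hT : 0 ≤ T)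
    (hv : ∀ t, T ≤ t → 0 < v t) (hu : ∀ t, T ≤ t → u t ≤ 0) : False := by
  have ha := h.ha
  have h1 := mono_of_hasDeriv (T := T) (f := fun t => v t * Real.exp (-(a * t)))
    (f' := fun t => - (G t * u t) * Real.exp (-(a * t)))
    (fun t => by
      have h2 : HasDerivAt (fun t : ℝ => Real.exp (-(a * t))) (Real.exp (-(a * t)) * (-(a * 1))) t :=
        (((hasDerivAt_id t).const_mul a).neg).exp
      exact ((h.hv t).mul h2).congr_deriv (by ring))
    (fun t ht => by
      have := mul_nonneg (h.hG t (hT.trans ht)).le (neg_nonneg.2 (hu t ht))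
      have := mul_nonneg this (Real.exp_pos (-(a * t))).le
      linarith)
  set c := v T * Real.exp (-(a * T)) with hc
  have hcpos : 0 < c := mul_pos (hv T le_rfl) (Real.exp_pos _)
  have h2 : ∀ t, T ≤ t → c * Real.exp (a * t) ≤ v t := by
    intro t ht
    have := mul_le_mul_of_nonneg_right (h1 t ht) (Real.exp_pos (a * t)).le
    simp only [mul_assoc, ← Real.exp_add] at this
    simp only [neg_add_cancel, Real.exp_zero, mul_one] at this
    exact this
  obtain ⟨d, hd, hdG⟩ := h.hgr c hcpos
  have h3 := mono_of_hasDeriv (T := T) (f := fun t => u t - d * c * t)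
    (f' := fun t => (G t * v t - a * u t) - d * c * 1)
    (fun t => (h.hu t).sub ((hasDerivAt_id t).const_mul (d * c)))
    (fun t ht => by
      have e1 := h2 t ht
      have e2 := hdG t (hT.trans ht) (e1.trans (le_abs_self _))
      have e3 : 1 ≤ Real.exp (a * t) := Real.one_le_exp (mul_nonneg ha.le (hT.trans ht))
      have e4 : c ≤ v t := by nlinarith
      have e5 : d * c ≤ G t * v t := mul_le_mul e2 e4 hcpos.le (hd.le.trans e2)
      have e6 := mul_nonneg ha.le (neg_nonneg.2 (hu t ht))
      linarith)
  have hdc : 0 < d * c := mul_pos hd hcpos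
  have hle : T ≤ T + (1 - u T) / (d * c) := by
    have : 0 ≤ (1 - u T) / (d * c) := div_nonneg (by linarith [hu T le_rfl]) hdc.le
    linarith
  have h4 := h3 _ hle
  have h5 := hu _ hle
  simp only [mul_add, mul_div_cancel₀ _ hdc.ne'] at h4
  linarith

/-- Eventually `v ≥ 0`. -/
theorem GoodS.caseV {a : ℝ} {G u v : ℝ → ℝ} (h : GoodS a G u v) 
    (hv : ∀ᶠ t in atTop, 0 ≤ v t) : ∀ᶠ t in atTop, 0 < u t * v t := by
  obtain ⟨T0, hT0⟩ := eventually_atTop.1 hv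
  set T := max T0 0 + 1 with hT
  have hT1 : T0 < T := by have := le_max_left T0 0; linarith
  have hT2 : 0 < T := by have := le_max_right T0 0; linarith
  have hvp : ∀ t, T ≤ t → 0 < v t := by
    intro t ht
    rcases lt_or_eq_of_le (hT0 t (by linarith)) with h1 | h1
    · exact h1
    exfalso
    have hmin : IsLocalMin v t := by
      filter_upwards [lt_mem_nhds (show T0 < t by linarith)] with s hs
      rw [← h1]; exact hT0 s hs.le
    have h2 := hmin.hasDerivAt_eq_zero (h.hv t)
    have h3 := h.hr t (by linarith)
    rw [← h1] at h2 h3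
    have h4 : G t * u t = 0 := by linarith
    rcases mul_eq_zero.1 h4 with h5 | h5
    · exact (h.hG t (by linarith)).ne' h5
    · rw [h5] at h3; norm_num at h3
  by_cases hu : ∀ t, T ≤ t → u t ≤ 0
  · exact (h.noK hT2.le hvp hu).elim
  push Not at hu
  obtain ⟨t1, ht1, hu1⟩ := hu
  have := pos_stays h.hu hu1 (fun t ht hz => by
    rw [hz]
    have := mul_pos (h.hG t (by linarith)) (hvp t (by linarith))
    linarith)
  filter_upwards [eventually_ge_atTop t1] with t ht
  exact mul_pos (this t ht) (hvp t (by linarith))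

/-- Eventually `u ≥ 0`. -/
theorem GoodS.caseU {a : ℝ} {G u v : ℝ → ℝ} (h : GoodS a G u v) 
    (hu : ∀ᶠ t in atTop, 0 ≤ u t) : ∀ᶠ t in atTop, 0 < u t * v t := by
  by_cases hv : ∀ᶠ t in atTop, 0 ≤ v t
  · exact h.caseV hv
  obtain ⟨T0, hT0⟩ := eventually_atTop.1 hu
  set T := max T0 0 + 1 with hT
  have hT1 : T0 < T := by have := le_max_left T0 0; linarith
  have hT2 : 0 < T := by have := le_max_right T0 0; linarith
  have hup : ∀ t, T ≤ t → 0 < u t := by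
    intro t ht
    rcases lt_or_eq_of_le (hT0 t (by linarith)) with h1 | h1
    · exact h1
    exfalso
    have hmin : IsLocalMin u t := by
      filter_upwards [lt_mem_nhds (show T0 < t by linarith)] with s hs
      rw [← h1]; exact hT0 s hs.le
    have h2 := hmin.hasDerivAt_eq_zero (h.hu t)
    have h3 := h.hr t (by linarith)
    rw [← h1] at h2 h3
    have h4 : G t * v t = 0 := by linarith
    rcases mul_eq_zero.1 h4 with h5 | h5
    · exact (h.hG t (by linarith)).ne' h5
    · rw [h5] at h3; norm_num at h3
  rw [not_eventually] at hv
  obtain ⟨t1, ht1, hv1⟩ := frequently_atTop.1 hv T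
  have := pos_stays h.neg.hv (show 0 < - v t1 by linarith) (fun t ht hz => by
    rw [hz]
    have := mul_pos (h.hG t (by linarith)) (hup t (by linarith))
    linarith)
  exact (h.neg.noK (T := t1) (by linarith) this
    (fun t ht => by have := hup t (by linarith); linarith)).elim

theorem GoodS.main {a : ℝ} {G u v : ℝ → ℝ} (h : GoodS a G u v) 
    (hc : ((∀ᶠ t in atTop, 0 ≤ v t) ∨ (∀ᶠ t in atTop, v t ≤ 0)) ∨
      ((∀ᶠ t in atTop, 0 ≤ u t) ∨ (∀ᶠ t in atTop, u t ≤ 0))) :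
    ∀ᶠ t in atTop, 0 < u t * v t := by
  rcases hc with (hc | hc) | (hc | hc)
  · exact h.caseV hc
  · have := h.neg.caseV (hc.mono fun t ht => by linarith)
    exact this.mono fun t ht => by linarith
  · exact h.caseU hc
  · have := h.neg.caseU (hc.mono fun t ht => by linarith)
    exact this.mono fun t ht => by linarith

theorem IsSolS2.good {m : ℕ} (hm : 3 ≤ m) {u v : ℝ → ℝ} (h : IsSolS2 m u v)
    (h0 : 0 < u 0 ^ 2 + v 0 ^ 2) :
    GoodS (((m : ℝ) - 2) / 2) (fun t => Real.cosh t ^ (-(1 : ℝ) / ((m : ℝ) - 1))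
        * ((u t) ^ 2 + (v t) ^ 2) ^ ((1 : ℝ) / ((m : ℝ) - 1))) u v := by
  have hm' : (3 : ℝ) ≤ m := by exact_mod_cast hm
  set a := ((m : ℝ) - 2) / 2 with ha
  have ha1 : 1 ≤ 2 * a := by rw [ha]; linarith
  set p := (1 : ℝ) / ((m : ℝ) - 1) with hp
  have hp0 : 0 < p := by rw [hp]; apply div_pos <;> linarith
  have hr : ∀ t, 0 ≤ t → 0 < u t ^ 2 + v t ^ 2 := by
    intro t ht
    have h1 := mono_of_hasDeriv (T := 0)
      (f := fun t => (u t ^ 2 + v t ^ 2) * Real.exp (2 * a * t))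
      (f' := fun t => 4 * a * v t ^ 2 * Real.exp (2 * a * t))
      (fun t => by
        have h2 : HasDerivAt (fun t : ℝ => Real.exp (2 * a * t))
          (Real.exp (2 * a * t) * (2 * a * 1)) t := ((hasDerivAt_id t).const_mul (2 * a)).exp
        exact ((((h t).1.pow 2).add ((h t).2.pow 2)).mul h2).congr_deriv (by
          simp only [Pi.add_apply, Pi.pow_apply]
          push_cast
          ring))
      (fun t _ => by
        have : 0 ≤ a := by linarith
        positivity) t ht
    simp only [mul_zero, Real.exp_zero, mul_one] at h1
    exact pos_of_mul_pos_left (lt_of_lt_of_le h0 h1) (Real.exp_pos _).le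
  refine ⟨by linarith, fun t ht => ?_, hr, fun t => (h t).1, fun t => (h t).2, ?_⟩
  · exact mul_pos (Real.rpow_pos_of_pos (Real.cosh_pos t) _) (Real.rpow_pos_of_pos (hr t ht) _)
  · intro c hc
    refine ⟨(c ^ 2) ^ p, by positivity, fun t ht hvt => ?_⟩
    have hcp := Real.cosh_pos t
    have hneg : -(1 : ℝ) / ((m : ℝ) - 1) = -p := by rw [hp]; ring
    have hch : Real.cosh t ≤ Real.exp t := by
      rw [Real.cosh_eq]
      have : Real.exp (-t) ≤ Real.exp t := Real.exp_le_exp.2 (by linarith)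
      linarith
    have e1 : c ^ 2 * Real.exp (2 * a * t) ≤ v t ^ 2 := by
      have := pow_le_pow_left₀ (by positivity) hvt 2
      rw [sq_abs, mul_pow, ← Real.exp_nat_mul] at this
      have e0 : 2 * a * t = ((2 : ℕ) : ℝ) * (a * t) := by push_cast; ring
      rw [e0]; exact this
    have e2 : Real.exp t ≤ Real.exp (2 * a * t) := Real.exp_le_exp.2 (by nlinarith)
    have e3 : c ^ 2 * Real.cosh t ≤ u t ^ 2 + v t ^ 2 := by
      have := mul_le_mul_of_nonneg_left (hch.trans e2) (sq_nonneg c)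
      nlinarith [sq_nonneg (u t)]
    have e4 := Real.rpow_le_rpow (by positivity) e3 hp0.le
    rw [Real.mul_rpow (by positivity) hcp.le] at e4
    show _ ≤ Real.cosh t ^ (-(1 : ℝ) / ((m : ℝ) - 1)) * _
    rw [hneg, Real.rpow_neg hcp.le, inv_mul_eq_div, le_div_iff₀ (by positivity)]
    exact e4

theorem IsSolS2.refl {m : ℕ} {u v : ℝ → ℝ} (h : IsSolS2 m u v) :
    IsSolS2 m (fun t => v (-t)) (fun t => u (-t)) := by
  intro t
  have h1 := (h (-t)).1.scomp t (hasDerivAt_neg t)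
  have h2 := (h (-t)).2.scomp t (hasDerivAt_neg t)
  refine ⟨h2.congr_deriv ?_, h1.congr_deriv ?_⟩
  · simp only [Real.cosh_neg, smul_eq_mul, add_comm (u (-t) ^ 2)]; ring
  · simp only [Real.cosh_neg, smul_eq_mul, add_comm (u (-t) ^ 2)]; ring

theorem many_changes {w : ℝ → ℝ} (h1 : ∃ᶠ t in atTop, 0 < w t) (h2 : ∃ᶠ t in atTop, w t < 0)
    (k : ℕ) : ChangesSignAtLeast w Set.univ k := by
  have a1 : ∀ t : ℝ, ∃ s, t < s ∧ 0 < w s := fun t => by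
    obtain ⟨s, hs, h⟩ := frequently_atTop.1 h1 (t + 1)
    exact ⟨s, by linarith, h⟩
  have a2 : ∀ t : ℝ, ∃ s, t < s ∧ w s < 0 := fun t => by
    obtain ⟨s, hs, h⟩ := frequently_atTop.1 h2 (t + 1)
    exact ⟨s, by linarith, h⟩
  choose f hf hf' using a1
  choose g hg hg' using a2
  let s : ℕ → ℝ := fun n => Nat.rec (f 0) (fun _ x => if 0 < w x then g x else f x) n
  have hs : ∀ n, s (n + 1) = if 0 < w (s n) then g (s n) else f (s n) := fun n => rfl
  have hne : ∀ n, w (s n) ≠ 0 := by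
    intro n
    cases n with
    | zero => exact (hf' 0).ne'
    | succ n =>
      rw [hs]; split_ifs
      · exact (hg' _).ne
      · exact (hf' _).ne'
  have hmono : StrictMono s := strictMono_nat_of_lt_succ fun n => by
    rw [hs]; split_ifs
    · exact hg _
    · exact hf _
  refine ⟨s, fun _ _ => Set.mem_univ _, fun i j hij _ => hmono hij, fun i _ => ?_⟩
  rw [hs]; split_ifs with hp
  · exact mul_neg_of_pos_of_neg hp (hg' _)
  · exact mul_neg_of_neg_of_pos (lt_of_le_of_ne (not_lt.1 hp) (hne i)) (hf' _)

theorem ev_sign {w : ℝ → ℝ} {k : ℕ} (h : ¬ ChangesSignAtLeast w Set.univ k) :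
    (∀ᶠ t in atTop, 0 ≤ w t) ∨ (∀ᶠ t in atTop, w t ≤ 0) := by
  by_contra hcon
  push Not at hcon
  refine h (many_changes ?_ ?_ k)
  · exact (by simpa using hcon.2)
  · exact (by simpa using hcon.1)

theorem changes_refl {w : ℝ → ℝ} {k : ℕ}
    (h : ChangesSignAtLeast (fun t => w (-t)) Set.univ k) : ChangesSignAtLeast w Set.univ k := by
  obtain ⟨s, -, h2, h3⟩ := h
  refine ⟨fun i => - s (k - i), fun _ _ => Set.mem_univ _, fun i j hij hj => ?_, fun i hi => ?_⟩
  · exact neg_lt_neg (h2 _ _ (by omega) (by omega))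
  · have := h3 (k - (i + 1)) (by omega)
    rw [show k - (i + 1) + 1 = k - i by omega] at this
    rw [mul_comm]
    exact this

theorem stmt12 (m : ℕ) (hm : 3 ≤ m) (μ : ℝ) (hμ : 0 < μ)
    (u v : ℝ → ℝ) (hsol : IsSolS2 m u v) (hu0 : u 0 = μ) (hv0 : v 0 = μ)
    (hfin : ∃ k : ℕ, ¬ ChangesSignAtLeast v Set.univ k) :
    ∃ T : ℝ, 0 < T ∧ ∀ t : ℝ, T ≤ |t| → 0 < u t * v t := by
  obtain ⟨k, hk⟩ := hfin
  have hr0 : 0 < u 0 ^ 2 + v 0 ^ 2 := by rw [hu0, hv0]; positivity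
  have h1 := (hsol.good hm hr0).main (Or.inl (ev_sign hk))
  have hr1 : 0 < (fun t => v (-t)) 0 ^ 2 + (fun t => u (-t)) 0 ^ 2 := by
    simp only [neg_zero]; linarith
  have h2 := (hsol.refl.good hm hr1).main
    (Or.inr (ev_sign (fun hh => hk (changes_refl hh))))
  obtain ⟨T, hT⟩ := eventually_atTop.1 (h1.and h2)
  refine ⟨max T 1, by positivity, fun t ht => ?_⟩
  have hle : T ≤ |t| := (le_max_left _ _).trans ht
  rcases le_total 0 t with h | h
  · rw [abs_of_nonneg h] at hle
    exact (hT t hle).1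
  · rw [abs_of_nonpos h] at hle
    have := (hT _ hle).2
    simp only [neg_neg] at this
    linarith
end
end

section
/- Let μ > 0 and let (u_μ, v_μ) be the solution of (S2) with u_μ(0) = v_μ(0) = μ. If (u_μ, v_μ) is bounded on ℝ and v_μ (or u_μ) changes sign only a finite number of times on ℝ, then there exist constants 0 < C₁ ≤ C₂ and T > 0 such that C₁·e^{−(m−2)|t|} ≤ u_μ(t)² + v_μ(t)² ≤ C₂·e^{−(m−2)|t|} for all |t| ≥ T; in particular u_μ(t)² + v_μ(t)² = O(e^{−(m−2)|t|}) as |t| → +∞. -/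
open Real Filter Set Topology

noncomputable section

lemma mono_aux {g g' : ℝ → ℝ} {T : ℝ} (hd : ∀ t, T ≤ t → HasDerivAt g (g' t) t)
    (hn : ∀ t, T ≤ t → 0 ≤ g' t) {s t : ℝ} (hs : T ≤ s) (hst : s ≤ t) : g s ≤ g t := by
  have : MonotoneOn g (Ici T) := by
    apply monotoneOn_of_deriv_nonneg (convex_Ici T)
    · intro x hx
      exact (hd x hx).continuousAt.continuousWithinAt
    · intro x hx
      rw [interior_Ici] at hx
      exact (hd x (le_of_lt hx)).differentiableAt.differentiableWithinAt
    · intro x hx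
      rw [interior_Ici] at hx
      rw [(hd x (le_of_lt hx)).deriv]
      exact hn x (le_of_lt hx)
  exact this hs (le_trans hs hst) hst

lemma exp_lin_deriv (c t : ℝ) : HasDerivAt (fun t => Real.exp (c * t)) (c * Real.exp (c * t)) t := by
  have h := ((hasDerivAt_id t).const_mul c).exp
  simp only [id] at h
  refine HasDerivAt.congr_deriv h ?_
  ring

lemma rho_deriv {a : ℝ} {f u v : ℝ → ℝ}
    (hu : ∀ t, HasDerivAt u (f t * v t - a * u t) t)
    (hv : ∀ t, HasDerivAt v (a * v t - f t * u t) t) (t : ℝ) :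
    HasDerivAt (fun t => u t ^ 2 + v t ^ 2) (2 * a * (v t ^ 2 - u t ^ 2)) t := by
  have h := ((hu t).pow 2).add ((hv t).pow 2)
  refine HasDerivAt.congr_deriv h ?_
  push_cast
  ring

lemma key_lower {a : ℝ} {f u v : ℝ → ℝ} (ha : 0 < a)
    (hu : ∀ t, HasDerivAt u (f t * v t - a * u t) t)
    (hv : ∀ t, HasDerivAt v (a * v t - f t * u t) t) (t : ℝ) (ht : 0 ≤ t) :
    (u 0 ^ 2 + v 0 ^ 2) * Real.exp (-(2 * a) * t) ≤ u t ^ 2 + v t ^ 2 := by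
  have h := mono_aux (T := 0) (fun t _ => (exp_lin_deriv (2 * a) t).mul (rho_deriv hu hv t))
    (fun t _ => by
      have := Real.exp_pos (2 * a * t)
      have h1 : 0 ≤ Real.exp (2 * a * t) * (4 * a * v t ^ 2) := by positivity
      nlinarith) le_rfl ht
  simp only [Pi.mul_apply, mul_zero, Real.exp_zero, one_mul] at h
  have e : Real.exp (2 * a * t) * Real.exp (-(2 * a) * t) = 1 := by
    rw [← Real.exp_add]; simp
  have := mul_le_mul_of_nonneg_right h (Real.exp_pos (-(2 * a) * t)).le
  calc _ ≤ _ := this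
    _ = (Real.exp (2 * a * t) * Real.exp (-(2 * a) * t)) * (u t ^ 2 + v t ^ 2) := by ring
    _ = _ := by rw [e, one_mul]

lemma key_upper {a q C M : ℝ} {f u v : ℝ → ℝ} (ha : 0 < a) (hq : 0 < q) (hC : 0 ≤ C)
    (hu : ∀ t, HasDerivAt u (f t * v t - a * u t) t)
    (hv : ∀ t, HasDerivAt v (a * v t - f t * u t) t)
    (hf0 : ∀ t, 0 ≤ t → 0 ≤ f t) (hf : ∀ t, 0 ≤ t → f t ≤ 2 * a * (C * Real.exp (-q * t)))
    (hM : ∀ t, v t ^ 2 ≤ M) :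
    ∃ D T : ℝ, 0 < T ∧ ∀ t, T ≤ t → u t ^ 2 + v t ^ 2 ≤ D * Real.exp (-(2 * a) * t) := by
  obtain ⟨T, hT0, hT⟩ : ∃ T : ℝ, 0 < T ∧ ∀ t, T ≤ t → C * Real.exp (-q * t) ≤ 1 / 4 := by
    have h : Tendsto (fun t : ℝ => C * Real.exp (-q * t)) atTop (𝓝 (C * 0)) := by
      apply Tendsto.const_mul
      apply Real.tendsto_exp_atBot.comp
      exact tendsto_id.const_mul_atTop_of_neg (by linarith)
    rw [mul_zero] at h
    obtain ⟨T, hT⟩ := eventually_atTop.1 (h.eventually (eventually_le_nhds (by norm_num : (0 : ℝ) < 1 / 4)))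
    exact ⟨max T 1, by positivity, fun t ht => hT t (le_trans (le_max_left _ _) ht)⟩
  have hε : ∀ t, HasDerivAt (fun t => C * Real.exp (-q * t)) (C * (-q * Real.exp (-q * t))) t :=
    fun t => (exp_lin_deriv (-q) t).const_mul C
  -- the invariant cone
  have cone : ∀ t, T ≤ t → v t ^ 2 ≤ C * Real.exp (-q * t) * (u t ^ 2 + v t ^ 2) := by
    intro t₀ ht₀
    by_contra hcon
    push Not at hcon
    have hz : ∀ t, HasDerivAt
        (fun t => Real.exp (-a * t) * (v t ^ 2 - C * Real.exp (-q * t) * (u t ^ 2 + v t ^ 2)))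
        (-a * Real.exp (-a * t) * (v t ^ 2 - C * Real.exp (-q * t) * (u t ^ 2 + v t ^ 2))
          + Real.exp (-a * t) * (2 * v t * (a * v t - f t * u t)
            - (C * (-q * Real.exp (-q * t)) * (u t ^ 2 + v t ^ 2)
              + C * Real.exp (-q * t) * (2 * a * (v t ^ 2 - u t ^ 2))))) t := by
      intro t
      have h := (exp_lin_deriv (-a) t).mul (((hv t).pow 2).sub ((hε t).mul (rho_deriv hu hv t)))
      refine HasDerivAt.congr_deriv h ?_
      simp only [Pi.sub_apply, Pi.mul_apply, Pi.pow_apply]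
      push_cast
      ring
    have hmono : ∀ t, t₀ ≤ t → _ := fun t ht => mono_aux (T := T) (fun t _ => hz t) (fun t ht => by
      have h0 := hf0 t (by linarith)
      have h1 := hf t (by linarith)
      have h2 := hT t ht
      have h3 : 0 ≤ C * Real.exp (-q * t) := by positivity
      have h3' : 0 ≤ C * (q * Real.exp (-q * t)) * (u t ^ 2 + v t ^ 2) := by positivity
      have h4 : 2 * f t * (u t * v t) ≤ f t * (u t ^ 2 + v t ^ 2) := by
        nlinarith [mul_nonneg h0 (sq_nonneg (u t - v t))]
      have h5 : f t * (u t ^ 2 + v t ^ 2) ≤ 2 * a * (C * Real.exp (-q * t)) * (u t ^ 2 + v t ^ 2) :=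
        mul_le_mul_of_nonneg_right h1 (by positivity)
      have h7 : 0 ≤ a * v t ^ 2 * (1 - 4 * (C * Real.exp (-q * t))) :=
        mul_nonneg (by positivity) (by linarith)
      have h8 : 0 ≤ a * (C * Real.exp (-q * t)) * (u t ^ 2 + v t ^ 2) := by positivity
      have h6 : 0 ≤ Real.exp (-a * t) * (-a * (v t ^ 2 - C * Real.exp (-q * t) * (u t ^ 2 + v t ^ 2))
          + (2 * v t * (a * v t - f t * u t)
            - (C * (-q * Real.exp (-q * t)) * (u t ^ 2 + v t ^ 2)
              + C * Real.exp (-q * t) * (2 * a * (v t ^ 2 - u t ^ 2))))) := by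
        apply mul_nonneg (Real.exp_pos _).le
        linarith
      linarith) ht₀ ht
    set c := Real.exp (-a * t₀) * (v t₀ ^ 2 - C * Real.exp (-q * t₀) * (u t₀ ^ 2 + v t₀ ^ 2)) with hc
    have hcpos : 0 < c := mul_pos (Real.exp_pos _) (by linarith)
    have hlim : Tendsto (fun t : ℝ => Real.exp (-a * t) * M) atTop (𝓝 (0 * M)) := by
      apply Tendsto.mul_const
      apply Real.tendsto_exp_atBot.comp
      exact tendsto_id.const_mul_atTop_of_neg (by linarith)
    rw [zero_mul] at hlim
    have : c ≤ 0 := by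
      apply ge_of_tendsto hlim
      filter_upwards [eventually_ge_atTop t₀] with t ht
      apply (hmono t ht).trans
      apply mul_le_mul_of_nonneg_left _ (Real.exp_pos _).le
      have : 0 ≤ C * Real.exp (-q * t) * (u t ^ 2 + v t ^ 2) := by positivity
      linarith [hM t]
    linarith
  -- now the upper bound
  set E : ℝ → ℝ := fun t => Real.exp (4 * a / q * (C * Real.exp (-q * t))) with hE
  have hEd : ∀ t, HasDerivAt E (E t * (4 * a / q * (C * (-q * Real.exp (-q * t))))) t :=
    fun t => ((hε t).const_mul (4 * a / q)).exp
  have hy := fun t (ht : T ≤ t) => mono_aux (T := T) (g := fun t => -(E t * (Real.exp (2 * a * t) * (u t ^ 2 + v t ^ 2))))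
    (g' := fun t => E t * Real.exp (2 * a * t) * (4 * a) *
      (C * Real.exp (-q * t) * (u t ^ 2 + v t ^ 2) - v t ^ 2))
    (fun t _ => by
      have h := ((hEd t).mul ((exp_lin_deriv (2 * a) t).mul (rho_deriv hu hv t))).neg
      refine HasDerivAt.congr_deriv h ?_
      simp only [Pi.mul_apply]
      field_simp
      ring)
    (fun t ht => by
      have := cone t ht
      have hEp : 0 < E t := Real.exp_pos _
      apply mul_nonneg (by positivity) (by linarith)) le_rfl ht
  refine ⟨E T * (Real.exp (2 * a * T) * (u T ^ 2 + v T ^ 2)), T, hT0, fun t ht => ?_⟩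
  have h := hy t ht
  have hE1 : 1 ≤ E t := Real.one_le_exp (by positivity)
  have e : Real.exp (2 * a * t) * Real.exp (-(2 * a) * t) = 1 := by
    rw [← Real.exp_add]; simp
  have h2 : Real.exp (2 * a * t) * (u t ^ 2 + v t ^ 2) ≤ E t * (Real.exp (2 * a * t) * (u t ^ 2 + v t ^ 2)) :=
    le_mul_of_one_le_left (by positivity) hE1
  have h3 := mul_le_mul_of_nonneg_right
    (h2.trans (neg_le_neg_iff.1 h)) (Real.exp_pos (-(2 * a) * t)).le
  calc u t ^ 2 + v t ^ 2 = (Real.exp (2 * a * t) * Real.exp (-(2 * a) * t)) * (u t ^ 2 + v t ^ 2) := by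
        rw [e, one_mul]
    _ = Real.exp (2 * a * t) * (u t ^ 2 + v t ^ 2) * Real.exp (-(2 * a) * t) := by ring
    _ ≤ _ := h3

lemma half_line {m : ℕ} (hm : 3 ≤ m) {u v : ℝ → ℝ} (hsol : IsSolS2 m u v) {M : ℝ}
    (hM : ∀ t, |u t| + |v t| ≤ M) :
    (∀ t, 0 ≤ t → (u 0 ^ 2 + v 0 ^ 2) * Real.exp (-((m : ℝ) - 2) * t) ≤ u t ^ 2 + v t ^ 2) ∧
    ∃ D T : ℝ, 0 < T ∧ ∀ t, T ≤ t → u t ^ 2 + v t ^ 2 ≤ D * Real.exp (-((m : ℝ) - 2) * t) := by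
  have hm' : (3 : ℝ) ≤ m := by exact_mod_cast hm
  have hq : 0 < 1 / ((m : ℝ) - 1) := by apply div_pos one_pos; linarith
  have ha : 0 < ((m : ℝ) - 2) / 2 := by linarith
  have e : -((m : ℝ) - 2) = -(2 * (((m : ℝ) - 2) / 2)) := by ring
  have hsq : ∀ t, u t ^ 2 + v t ^ 2 ≤ M ^ 2 := fun t => by
    have := hM t
    have h1 := abs_nonneg (u t)
    have h2 := abs_nonneg (v t)
    rw [← sq_abs (u t), ← sq_abs (v t)]
    nlinarith
  have hu := fun t => (hsol t).1
  have hv := fun t => (hsol t).2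
  rw [e]
  refine ⟨key_lower (f := fun t => Real.cosh t ^ (-(1 : ℝ) / ((m : ℝ) - 1))
        * ((u t) ^ 2 + (v t) ^ 2) ^ ((1 : ℝ) / ((m : ℝ) - 1))) ha hu hv, ?_⟩
  refine key_upper (q := 1 / ((m : ℝ) - 1)) (M := M ^ 2)
    (C := (1 / 2 : ℝ) ^ (-(1 : ℝ) / ((m : ℝ) - 1)) * (M ^ 2) ^ ((1 : ℝ) / ((m : ℝ) - 1)) / ((m : ℝ) - 2))
    (f := fun t => Real.cosh t ^ (-(1 : ℝ) / ((m : ℝ) - 1))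
        * ((u t) ^ 2 + (v t) ^ 2) ^ ((1 : ℝ) / ((m : ℝ) - 1))) ha hq ?_ hu hv ?_ ?_ ?_
  · apply div_nonneg (by positivity); linarith
  · intro t _
    have := Real.cosh_pos t
    positivity
  · intro t _
    have h1 : Real.cosh t ^ (-(1 : ℝ) / ((m : ℝ) - 1)) ≤
        (1 / 2 : ℝ) ^ (-(1 : ℝ) / ((m : ℝ) - 1)) * Real.exp (-(1 / ((m : ℝ) - 1)) * t) := by
      have : (1 / 2 : ℝ) ^ (-(1 : ℝ) / ((m : ℝ) - 1)) * Real.exp (-(1 / ((m : ℝ) - 1)) * t)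
          = (1 / 2 * Real.exp t) ^ (-(1 : ℝ) / ((m : ℝ) - 1)) := by
        rw [Real.mul_rpow (by norm_num) (Real.exp_pos t).le, ← Real.exp_mul]
        congr 2
        ring
      rw [this]
      apply Real.rpow_le_rpow_of_nonpos (by positivity)
      · rw [Real.cosh_eq]
        have := Real.exp_pos (-t)
        linarith
      · rw [neg_div]; linarith
    have h2 : (u t ^ 2 + v t ^ 2) ^ ((1 : ℝ) / ((m : ℝ) - 1)) ≤ (M ^ 2) ^ ((1 : ℝ) / ((m : ℝ) - 1)) :=
      Real.rpow_le_rpow (by positivity) (hsq t) hq.le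
    have h3 := mul_le_mul h1 h2 (by positivity) (by positivity)
    refine h3.trans (le_of_eq ?_)
    have : (m : ℝ) - 2 ≠ 0 := by linarith
    field_simp
  · intro t
    have := hsq t
    nlinarith [sq_nonneg (u t)]

theorem stmt14 (m : ℕ) (hm : 3 ≤ m) (μ : ℝ) (hμ : 0 < μ)
    (u v : ℝ → ℝ) (hsol : IsSolS2 m u v) (hu0 : u 0 = μ) (hv0 : v 0 = μ)
    (hbdd : ∃ M : ℝ, ∀ t : ℝ, |u t| + |v t| ≤ M)
    (hfin : (∃ k : ℕ, ¬ ChangesSignAtLeast v Set.univ k) ∨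
            (∃ k : ℕ, ¬ ChangesSignAtLeast u Set.univ k)) :
    ∃ C₁ C₂ T : ℝ, 0 < C₁ ∧ C₁ ≤ C₂ ∧ 0 < T ∧
      ∀ t : ℝ, T ≤ |t| →
        C₁ * Real.exp (-((m : ℝ) - 2) * |t|) ≤ (u t) ^ 2 + (v t) ^ 2 ∧
        (u t) ^ 2 + (v t) ^ 2 ≤ C₂ * Real.exp (-((m : ℝ) - 2) * |t|) := by
  obtain ⟨M, hM⟩ := hbdd
  have hsol' : IsSolS2 m (fun t => v (-t)) (fun t => u (-t)) := by
    intro t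
    have h1 := (hsol (-t)).1.scomp t (hasDerivAt_neg t)
    have h2 := (hsol (-t)).2.scomp t (hasDerivAt_neg t)
    constructor
    · refine HasDerivAt.congr_deriv h2 ?_
      simp only [Real.cosh_neg, smul_eq_mul, add_comm (v (-t) ^ 2)]
      ring
    · refine HasDerivAt.congr_deriv h1 ?_
      simp only [Real.cosh_neg, smul_eq_mul, add_comm (v (-t) ^ 2)]
      ring
  obtain ⟨l1, D1, T1, hT1, k1⟩ := half_line hm hsol hM
  obtain ⟨l2, D2, T2, hT2, k2⟩ := half_line hm hsol' (M := M) (fun t => by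
    rw [add_comm]; exact hM (-t))
  simp only [neg_zero, hu0, hv0] at l1 l2
  refine ⟨μ ^ 2 + μ ^ 2, max (μ ^ 2 + μ ^ 2) (max D1 D2), max T1 T2, by positivity,
    le_max_left _ _, lt_max_of_lt_left hT1, fun t ht => ?_⟩
  have hx : ∀ D s : ℝ, D ≤ max (μ ^ 2 + μ ^ 2) (max D1 D2) → D * Real.exp s ≤
      max (μ ^ 2 + μ ^ 2) (max D1 D2) * Real.exp s := fun D s h =>
    mul_le_mul_of_nonneg_right h (Real.exp_pos s).le
  rcases le_total 0 t with h | h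
  · rw [abs_of_nonneg h] at ht ⊢
    exact ⟨l1 t h, (k1 t ((le_max_left _ _).trans ht)).trans
      (hx _ _ ((le_max_left _ _).trans (le_max_right _ _)))⟩
  · rw [abs_of_nonpos h] at ht ⊢
    have a1 := l2 (-t) (by linarith)
    have a2 := k2 (-t) ((le_max_right _ _).trans ht)
    simp only [neg_neg] at a1 a2
    rw [add_comm (v t ^ 2)] at a1 a2
    exact ⟨a1, a2.trans (hx _ _ ((le_max_right _ _).trans (le_max_right _ _)))⟩
end
end

section
/- For every k ∈ ℕ ∪ {0}, the set B_k is empty: there is no μ > 0 such that v_μ changes sign exactly k times on (0,+∞), H_μ(t) > 0 for all t ∈ ℝ, and (u_μ, v_μ) is unbounded on ℝ. -/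
open Real Filter Set Topology

noncomputable section

theorem bdd_aux (m : ℕ) (hm : 3 ≤ m) (u v : ℝ → ℝ) (hs : IsSolS2 m u v)
    (hH : ∀ t : ℝ, 0 < H2 m t (u t) (v t)) :
    ∃ M : ℝ, ∀ t : ℝ, 1 ≤ t → u t ^ 2 + v t ^ 2 ≤ M := by
  have hm' : (3 : ℝ) ≤ m := by exact_mod_cast hm
  obtain ⟨a, ha⟩ : ∃ a : ℝ, a = ((m : ℝ) - 2) / 2 := ⟨_, rfl⟩
  obtain ⟨p, hp⟩ : ∃ p : ℝ, p = (1 : ℝ) / ((m : ℝ) - 1) := ⟨_, rfl⟩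
  have hm1 : (0 : ℝ) < (m : ℝ) - 1 := by linarith
  have ha0 : 1 ≤ 2 * a := by rw [ha]; linarith
  have hp0 : 0 < p := by rw [hp]; positivity
  have hq : -(1 : ℝ) / ((m : ℝ) - 1) = -p := by rw [hp]; ring
  have hmp : (m : ℝ) / ((m : ℝ) - 1) = p + 1 := by rw [hp]; field_simp; ring
  have hκ : ((m : ℝ) - 1) / (2 * (m : ℝ)) * (p + 1) = 1 / 2 := by rw [hp]; field_simp; ring
  have hκp : ((m : ℝ) - 1) / (2 * (m : ℝ)) * p = 1 / (2 * m) := by rw [hp]; field_simp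
  obtain ⟨κ, hκd⟩ : ∃ κ : ℝ, κ = ((m : ℝ) - 1) / (2 * (m : ℝ)) := ⟨_, rfl⟩
  have hκ0 : 0 < κ := by rw [hκd]; positivity
  rw [← hκd] at hκ hκp
  obtain ⟨Q, hQ⟩ : ∃ Q : ℝ → ℝ, ∀ t, Q t = cosh t ^ (-p) * (u t ^ 2 + v t ^ 2) ^ p :=
    ⟨_, fun _ => rfl⟩
  have hQ0 : ∀ t, 0 ≤ Q t := by
    intro t; rw [hQ]
    have := cosh_pos t
    positivity
  have hu : ∀ t, HasDerivAt u (Q t * v t - a * u t) t := by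
    intro t
    have := (hs t).1
    rw [hq, ← hp, ← ha, ← hQ] at this
    exact this
  have hv : ∀ t, HasDerivAt v (a * v t - Q t * u t) t := by
    intro t
    have := (hs t).2
    rw [hq, ← hp, ← ha, ← hQ] at this
    exact this
  have hR0 : ∀ t, 0 ≤ u t ^ 2 + v t ^ 2 := fun t => by positivity
  have hpow : ∀ t, (u t ^ 2 + v t ^ 2) ^ (p + 1) = (u t ^ 2 + v t ^ 2) ^ p * (u t ^ 2 + v t ^ 2) := by
    intro t
    rw [rpow_add_of_nonneg (hR0 t) hp0.le zero_le_one, rpow_one]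
  have hHe : ∀ t, H2 m t (u t) (v t) = -a * u t * v t + κ * cosh t ^ (-p) * (u t ^ 2 + v t ^ 2) ^ (p + 1) := by
    intro t
    simp only [H2]
    rw [hq, hmp, ← hκd, ← ha]
  have hHG : ∀ t, H2 m t (u t) (v t) = -a * (u t * v t) + κ * (Q t * (u t ^ 2 + v t ^ 2)) := by
    intro t
    rw [hHe, hpow, hQ]; ring
  have hHd : ∀ t, HasDerivAt (fun t => H2 m t (u t) (v t))
      (-(1 / (2 * m)) * tanh t * (Q t * (u t ^ 2 + v t ^ 2))) t := by
    intro t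
    have hfun : (fun t => H2 m t (u t) (v t)) = fun t => -a * u t * v t + κ * cosh t ^ (-p) * (u t ^ 2 + v t ^ 2) ^ (p + 1) := funext hHe
    rw [hfun]
    have h1 := (((hu t).const_mul (-a)).mul (hv t))
    have h2 := ((hasDerivAt_cosh t).rpow_const (p := -p) (Or.inl (cosh_pos t).ne')).const_mul κ
    have h3 := (((hu t).pow 2).add ((hv t).pow 2)).rpow_const (p := p + 1) (Or.inr (by linarith))
    have h4 := h1.add (h2.mul h3)
    refine h4.congr_deriv ?_
    have e1 : cosh t ^ (-p - 1) = cosh t ^ (-p) / cosh t := by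
      rw [rpow_sub (cosh_pos t), rpow_one]
    simp only [Pi.add_apply, Pi.pow_apply, add_sub_cancel_right]
    rw [e1, hpow, tanh_eq_sinh_div_cosh, hQ, ← hκp]
    have hc := (cosh_pos t).ne'
    generalize cosh t ^ (-p) = c
    generalize (u t ^ 2 + v t ^ 2) ^ p = r
    field_simp
    push_cast
    linear_combination (2 * c * r * cosh t * (u t * (c * r * v t - a * u t) + v t * (a * v t - c * r * u t))) * hκ
  obtain ⟨G, hG⟩ : ∃ G : ℝ → ℝ, ∀ t, G t = Q t * (u t ^ 2 + v t ^ 2) := ⟨_, fun _ => rfl⟩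
  have hG0 : ∀ t, 0 ≤ G t := fun t => by rw [hG]; exact mul_nonneg (hQ0 t) (hR0 t)
  simp only [← hG] at hHG hHd
  have hXd : ∀ t, HasDerivAt (fun t => u t * v t) (Q t * (v t ^ 2 - u t ^ 2)) t := by
    intro t
    refine ((hu t).mul (hv t)).congr_deriv ?_
    ring
  have htau : 0 < tanh 1 := by rw [tanh_eq_sinh_div_cosh]; exact div_pos (sinh_pos_iff.2 one_pos) (cosh_pos 1)
  have htm : ∀ t, 1 ≤ t → tanh 1 ≤ tanh t := by
    intro t ht
    rw [tanh_eq_sinh_div_cosh, tanh_eq_sinh_div_cosh, div_le_div_iff₀ (cosh_pos _) (cosh_pos _)]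
    have : 0 ≤ sinh (t - 1) := sinh_nonneg_iff.2 (by linarith)
    rw [sinh_sub] at this
    linarith
  -- upper bound on uv
  have hanti : AntitoneOn (fun t => u t * v t + (2 * m / tanh 1) * H2 m t (u t) (v t)) (Ici 1) := by
    have hd : ∀ t, HasDerivAt (fun t => u t * v t + (2 * m / tanh 1) * H2 m t (u t) (v t))
      (Q t * (v t ^ 2 - u t ^ 2) + (2 * m / tanh 1) * (-(1 / (2 * m)) * tanh t * G t)) t :=
      fun t => (hXd t).add ((hHd t).const_mul _)
    refine antitoneOn_of_deriv_nonpos (convex_Ici 1) (fun t _ => (hd t).continuousAt.continuousWithinAt)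
      (fun t _ => (hd t).differentiableAt.differentiableWithinAt) ?_
    intro t ht
    rw [interior_Ici, mem_Ioi] at ht
    rw [(hd t).deriv]
    have e : (2 * m / tanh 1) * (-(1 / (2 * m)) * tanh t * G t) = - (tanh t / tanh 1 * G t) := by
      field_simp
    rw [e]
    have h1 : 1 ≤ tanh t / tanh 1 := (one_le_div htau).2 (htm t ht.le)
    have h2 : Q t * (v t ^ 2 - u t ^ 2) ≤ G t := by
      rw [hG]
      exact mul_le_mul_of_nonneg_left (by nlinarith [sq_nonneg (u t)]) (hQ0 t)
    nlinarith [hG0 t]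
  have hHanti : AntitoneOn (fun t => H2 m t (u t) (v t)) (Ici 1) := by
    refine antitoneOn_of_deriv_nonpos (convex_Ici 1) (fun t _ => (hHd t).continuousAt.continuousWithinAt)
      (fun t _ => (hHd t).differentiableAt.differentiableWithinAt) ?_
    intro t ht
    rw [interior_Ici, mem_Ioi] at ht
    rw [(hHd t).deriv]
    have h1 := htau.trans_le (htm t ht.le)
    have := mul_nonneg (mul_nonneg (show (0:ℝ) ≤ 1 / (2 * m) by positivity) h1.le) (hG0 t)
    linarith
  obtain ⟨C, hC⟩ : ∃ C : ℝ, ∀ t, 1 ≤ t → G t ≤ C := by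
    refine ⟨(H2 m 1 (u 1) (v 1) + a * (u 1 * v 1 + (2 * m / tanh 1) * H2 m 1 (u 1) (v 1))) / κ, ?_⟩
    intro t ht
    rw [le_div_iff₀ hκ0]
    have h1 := hanti (mem_Ici.2 le_rfl) (mem_Ici.2 ht) ht
    have h2 := hHanti (mem_Ici.2 le_rfl) (mem_Ici.2 ht) ht
    simp only at h1 h2
    have h3 := hHG t
    have h4 : 0 ≤ (2 * m / tanh 1) * H2 m t (u t) (v t) := mul_nonneg (by positivity) (hH t).le
    have h5 := mul_le_mul_of_nonneg_left (show u t * v t ≤ u 1 * v 1 + (2 * m / tanh 1) * H2 m 1 (u 1) (v 1) by linarith)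
      (show 0 ≤ a by linarith)
    linarith
  have hXG1 : ∀ t, 2 * (Q t * (u t * v t)) ≤ G t := by
    intro t
    rw [hG]
    nlinarith [mul_nonneg (hQ0 t) (sq_nonneg (u t - v t))]
  obtain ⟨K, hK⟩ : ∃ K : ℝ, K = C / (2 * a) := ⟨_, rfl⟩
  have hKC : 2 * a * K = C := by rw [hK]; exact mul_div_cancel₀ _ (by linarith)
  have hC0 : 0 ≤ C := (hG0 1).trans (hC 1 le_rfl)
  have hK0 : 0 ≤ K := by rw [hK]; positivity
  have hed : ∀ b t : ℝ, HasDerivAt (fun t => exp (b * t)) (exp (b * t) * b) t := by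
    intro b t
    simpa using ((hasDerivAt_id t).const_mul b).exp
  have hw : ∀ t, 1 ≤ t → v t ^ 2 ≤ K := by
    intro t0 ht0
    by_contra hcon
    push Not at hcon
    have hd : ∀ t, HasDerivAt (fun t => (v t ^ 2 - K) * exp (-(2 * a) * t))
      ((2 * a * v t ^ 2 - 2 * (Q t * (u t * v t)) - 2 * a * (v t ^ 2 - K)) * exp (-(2 * a) * t)) t := by
      intro t
      refine ((((hv t).pow 2).sub_const K).mul (hed (-(2 * a)) t)).congr_deriv ?_
      simp only [Pi.pow_apply]
      push_cast
      ring
    have hmono : MonotoneOn (fun t => (v t ^ 2 - K) * exp (-(2 * a) * t)) (Ici 1) := by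
      refine monotoneOn_of_deriv_nonneg (convex_Ici 1) (fun t _ => (hd t).continuousAt.continuousWithinAt)
        (fun t _ => (hd t).differentiableAt.differentiableWithinAt) ?_
      intro t ht
      rw [interior_Ici, mem_Ioi] at ht
      rw [(hd t).deriv]
      refine mul_nonneg ?_ (exp_pos _).le
      linarith [hXG1 t, hC t ht.le]
    have hpos : 0 < v t0 ^ 2 - K := by linarith
    obtain ⟨δ, hδ⟩ : ∃ δ : ℝ, δ = (v t0 ^ 2 - K) * exp (-t0) := ⟨_, rfl⟩
    have hδ0 : 0 < δ := by rw [hδ]; positivity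
    have hgrow : ∀ t, t0 ≤ t → δ * exp t ≤ v t ^ 2 := by
      intro t ht
      have h1 := hmono (mem_Ici.2 ht0) (mem_Ici.2 (ht0.trans ht)) ht
      simp only at h1
      have h2 := mul_le_mul_of_nonneg_right h1 (exp_pos (2 * a * t)).le
      rw [mul_assoc (v t0 ^ 2 - K), mul_assoc (v t ^ 2 - K), ← exp_add, ← exp_add] at h2
      have e : -(2 * a) * t + 2 * a * t = 0 := by ring
      rw [e, exp_zero, mul_one] at h2
      have h3 : exp (-t0 + t) ≤ exp (-(2 * a) * t0 + 2 * a * t) := by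
        apply exp_le_exp.2
        nlinarith
      have h4 := mul_le_mul_of_nonneg_left h3 hpos.le
      rw [exp_add, ← mul_assoc, ← hδ] at h4
      linarith
    have hGl : ∀ t, t0 ≤ t → δ ^ p * (δ * t) ≤ G t := by
      intro t ht
      have h1 := hgrow t ht
      have hR : δ * exp t ≤ u t ^ 2 + v t ^ 2 := by nlinarith [sq_nonneg (u t)]
      have hcosh : cosh t ≤ exp t := by
        rw [cosh_eq]
        have : exp (-t) ≤ exp t := exp_le_exp.2 (by linarith)
        linarith
      have hQl : δ ^ p ≤ Q t := by
        rw [hQ, rpow_neg (cosh_pos t).le, mul_comm, ← div_eq_mul_inv, ← div_rpow (hR0 t) (cosh_pos t).le]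
        refine rpow_le_rpow hδ0.le ?_ hp0.le
        rw [le_div_iff₀ (cosh_pos t)]
        nlinarith
      rw [hG]
      refine mul_le_mul hQl ?_ (by have : 0 ≤ t := by linarith
                                   positivity) (hQ0 t)
      have := add_one_le_exp t
      nlinarith
    have hδp : 0 < δ ^ p * δ := by positivity
    have h1 := hGl (max t0 ((C + 1) / (δ ^ p * δ))) (le_max_left _ _)
    have h2 := hC (max t0 ((C + 1) / (δ ^ p * δ))) (ht0.trans (le_max_left _ _))
    have h3 := mul_le_mul_of_nonneg_left (le_max_right t0 ((C + 1) / (δ ^ p * δ))) hδp.le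
    rw [mul_div_cancel₀ _ hδp.ne'] at h3
    linarith
  refine ⟨(K + u 1 ^ 2) + K, fun t ht => add_le_add ?_ (hw t ht)⟩
  have hd : ∀ t, HasDerivAt (fun t => (u t ^ 2 - K) * exp (2 * a * t))
    ((2 * (Q t * (u t * v t)) - 2 * a * u t ^ 2 + 2 * a * (u t ^ 2 - K)) * exp (2 * a * t)) t := by
    intro t
    refine ((((hu t).pow 2).sub_const K).mul (hed (2 * a) t)).congr_deriv ?_
    simp only [Pi.pow_apply]
    push_cast
    ring
  have hant : AntitoneOn (fun t => (u t ^ 2 - K) * exp (2 * a * t)) (Ici 1) := by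
    refine antitoneOn_of_deriv_nonpos (convex_Ici 1) (fun t _ => (hd t).continuousAt.continuousWithinAt)
      (fun t _ => (hd t).differentiableAt.differentiableWithinAt) ?_
    intro t ht
    rw [interior_Ici, mem_Ioi] at ht
    rw [(hd t).deriv]
    refine mul_nonpos_of_nonpos_of_nonneg ?_ (exp_pos _).le
    linarith [hXG1 t, hC t ht.le]
  have h1 := hant (mem_Ici.2 le_rfl) (mem_Ici.2 ht) ht
  simp only at h1
  by_contra hcon
  push Not at hcon
  have h2 : exp (2 * a * 1) ≤ exp (2 * a * t) := exp_le_exp.2 (by nlinarith)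
  have h3 := exp_pos (2 * a * 1)
  have h4 : 0 ≤ u t ^ 2 - K := by nlinarith [sq_nonneg (u 1)]
  have h5 := mul_le_mul_of_nonneg_left h2 h4
  have h6 := le_of_mul_le_mul_right (h5.trans h1) h3
  linarith

theorem sol_rev (m : ℕ) (u v : ℝ → ℝ) (hs : IsSolS2 m u v) :
    IsSolS2 m (fun t => v (-t)) (fun t => u (-t)) := by
  intro t
  have h1 := (hs (-t)).1.comp t (hasDerivAt_neg t)
  have h2 := (hs (-t)).2.comp t (hasDerivAt_neg t)
  constructor
  · refine h2.congr_deriv ?_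
    rw [cosh_neg, add_comm (v (-t) ^ 2)]; ring
  · refine h1.congr_deriv ?_
    rw [cosh_neg, add_comm (v (-t) ^ 2)]; ring

theorem stmt16 (m : ℕ) (hm : 3 ≤ m) :
    ∀ (k : ℕ) (μ : ℝ), 0 < μ →
      ∀ u v : ℝ → ℝ, IsSolS2 m u v → u 0 = μ → v 0 = μ →
        ¬ (ChangesSignExactly v (Set.Ioi 0) k ∧
           (∀ t : ℝ, 0 < H2 m t (u t) (v t)) ∧
           ¬ ∃ M : ℝ, ∀ t : ℝ, |u t| + |v t| ≤ M) := by
  intro k μ _ u v hs _ _ ⟨_, hH, hunb⟩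
  apply hunb
  obtain ⟨M1, h1⟩ := bdd_aux m hm u v hs hH
  obtain ⟨M2, h2⟩ := bdd_aux m hm _ _ (sol_rev m u v hs) (by
    intro t
    have := hH (-t)
    simp only [H2] at this ⊢
    rw [cosh_neg, add_comm (u (-t) ^ 2)] at this
    linarith)
  have hcu : Continuous u := continuous_iff_continuousAt.2 fun t => (hs t).1.continuousAt
  have hcv : Continuous v := continuous_iff_continuousAt.2 fun t => (hs t).2.continuousAt
  obtain ⟨M3, h3⟩ := (isCompact_Icc (a := (-1 : ℝ)) (b := 1)).bddAbove_image
    (f := fun t => u t ^ 2 + v t ^ 2) (by fun_prop)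
  have key : ∀ t, u t ^ 2 + v t ^ 2 ≤ |M1| + |M2| + |M3| := by
    intro t
    have a1 := abs_nonneg M1
    have a2 := abs_nonneg M2
    have a3 := abs_nonneg M3
    have b1 := le_abs_self M1
    have b2 := le_abs_self M2
    have b3 := le_abs_self M3
    rcases le_total 1 t with h | h
    · linarith [h1 t h]
    · rcases le_total t (-1) with h' | h'
      · have := h2 (-t) (by linarith)
        simp only [neg_neg] at this
        linarith
      · have := h3 (mem_image_of_mem _ ⟨h', h⟩)
        linarith
  refine ⟨|M1| + |M2| + |M3| + 1, fun t => ?_⟩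
  have := key t
  rw [← sq_abs (u t), ← sq_abs (v t)] at this
  nlinarith [sq_nonneg (|u t| - 1 / 2), sq_nonneg (|v t| - 1 / 2)]
end
end
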